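/- Let w ∈ (0, ∞] and suppose (L_k, W_k) is any family of parameters with (1/L_k, W_k/L_k) → (0, w). If for each k, Q_k ∈ H_∞ is a finite-energy solution of the Euler–Lagrange equation L_k ΔQ = −aQ − b(Q² − (|Q|²/3)I) + c|Q|²Q in Ω with the weak anchoring boundary condition (L_k/W_k) ∂Q/∂ν = Q_s − Q on |x| = 1, then Q_k converges locally uniformly on the closure of Ω to the map Q₀ = Q_{0,w} given by Q₀(x) = s_*(w/(3+w))(1/r³)(e_r⊗e_r − I/3) + s_*(1 − (w/(1+w))(1/r))(e_z⊗e_z − I/3), where r = |x| and e_r = x/|x|. -/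

import Mathlib

open MeasureTheory Filter Metric Real Set
open scoped ENNReal NNReal
noncomputable section

abbrev E3 : Type := EuclideanSpace ℝ (Fin 3)
abbrev Mat3 : Type := Matrix (Fin 3) (Fin 3) ℝ

def isS0 (Q : Mat3) : Prop := Q.IsSymm ∧ Q.trace = 0
def minner (A B : Mat3) : ℝ := (A * B).trace
def mnormSq (A : Mat3) : ℝ := (A * A).trace
def mnorm (A : Mat3) : ℝ := Real.sqrt (mnormSq A)
def outer (u v : E3) : Mat3 := Matrix.of fun i j => u i * v j
def ez : E3 := EuclideanSpace.single 2 1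
def er (x : E3) : E3 := ‖x‖⁻¹ • x
def sstar (a b c : ℝ) : ℝ := (b + Real.sqrt (b ^ 2 + 24 * a * c)) / (4 * c)
def Qinf (a b c : ℝ) : Mat3 := sstar a b c • (outer ez ez - (1 / 3 : ℝ) • (1 : Mat3))
def Qsurf (a b c : ℝ) (x : E3) : Mat3 :=
  sstar a b c • (outer (er x) (er x) - (1 / 3 : ℝ) • (1 : Mat3))
def Omega : Set E3 := {x | 1 < ‖x‖}
def OmegaBar : Set E3 := {x | 1 ≤ ‖x‖}

def pd (g : E3 → ℝ) (k : Fin 3) : E3 → ℝ :=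
  fun x => fderivWithin ℝ g OmegaBar x (EuclideanSpace.single k 1)
def lap3 (g : E3 → ℝ) (x : E3) : ℝ := ∑ k, pd (pd g k) k x
def matLap (Q : E3 → Mat3) (x : E3) : Mat3 := Matrix.of fun i j => lap3 (fun y => Q y i j) x
def gradSq (Q : E3 → Mat3) (x : E3) : ℝ := ∑ i, ∑ j, ∑ k, (pd (fun y => Q y i j) k x) ^ 2
def nuDeriv (Q : E3 → Mat3) (x : E3) : Mat3 :=
  Matrix.of fun i j => fderivWithin ℝ (fun y => Q y i j) OmegaBar x (-(er x))

def gradf (a b c : ℝ) (Q : Mat3) : Mat3 :=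
  (-a) • Q - b • (Q * Q - (mnormSq Q / 3) • (1 : Mat3)) + (c * mnormSq Q) • Q

def gpot (a b c : ℝ) (Q : Mat3) : ℝ :=
  -(a / 2) * (Q * Q).trace - (b / 3) * (Q * Q * Q).trace + (c / 4) * ((Q * Q).trace) ^ 2
def Cconst (a b c : ℝ) : ℝ := -sInf (gpot a b c '' {Q | isS0 Q})
def fpot (a b c : ℝ) (Q : Mat3) : ℝ := gpot a b c Q + Cconst a b c

def RegC (m : ℕ) (Q : E3 → Mat3) : Prop :=
  ∀ i j, ContDiffOn ℝ m (fun x => Q x i j) OmegaBar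

def memH (a b c : ℝ) (Q : E3 → Mat3) : Prop :=
  (∀ x ∈ OmegaBar, isS0 (Q x)) ∧
  IntegrableOn (fun x => gradSq Q x) Omega volume ∧
  IntegrableOn (fun x => mnormSq (Q x - Qinf a b c) / ‖x‖ ^ 2) Omega volume

def isEL (a b c L : ℝ) (Q : E3 → Mat3) : Prop :=
  ∀ x ∈ Omega, L • matLap Q x = gradf a b c (Q x)

def weakAnchor (a b c L W : ℝ) (Q : E3 → Mat3) : Prop :=
  ∀ x : E3, ‖x‖ = 1 → (L / W) • nuDeriv Q x = Qsurf a b c x - Q x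

def coef1 (w : ℝ≥0∞) : ℝ := if w = ⊤ then 1 else w.toReal / (1 + w.toReal)
def coef3 (w : ℝ≥0∞) : ℝ := if w = ⊤ then 1 else w.toReal / (3 + w.toReal)

def Q0 (a b c : ℝ) (w : ℝ≥0∞) (x : E3) : Mat3 :=
  (sstar a b c * coef3 w / ‖x‖ ^ 3) • (outer (er x) (er x) - (1 / 3 : ℝ) • (1 : Mat3))
  + (sstar a b c * (1 - coef1 w / ‖x‖)) • (outer ez ez - (1 / 3 : ℝ) • (1 : Mat3))

def repeatedEig (Q : Mat3) : Prop := ∃ t : ℝ, 2 ≤ Polynomial.rootMultiplicity t (Matrix.charpoly Q)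

def vec3 (p q r : ℝ) : E3 := (WithLp.equiv 2 (Fin 3 → ℝ)).symm ![p, q, r]

section

open scoped Topology

/-- The `k`-th partial derivative of a scalar function on `ℝ³`. -/
def partialD (k : Fin 3) (f : E3 → ℝ) (x : E3) : ℝ :=
  fderiv ℝ f x (EuclideanSpace.single k 1)

/-- Second order necessary condition at a local maximum in one variable. -/
theorem second_deriv_nonpos_of_isLocalMax {φ φ' : ℝ → ℝ} {d : ℝ} (hmax : IsLocalMax φ 0)
    (h1 : ∀ᶠ t in 𝓝 (0 : ℝ), HasDerivAt φ (φ' t) t) (h2 : HasDerivAt φ' d 0) : d ≤ 0 := by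
  by_contra! hd
  have e1 : deriv φ =ᶠ[𝓝 0] φ' := h1.mono fun t ht => ht.deriv
  have e2 : deriv (deriv φ) 0 = d := by rw [e1.deriv_eq]; exact h2.deriv
  have e3 : deriv φ 0 = 0 := hmax.deriv_eq_zero
  have hmin := isLocalMin_of_deriv_deriv_pos (f := φ) (x₀ := 0) (by rw [e2]; exact hd) e3
    h1.self_of_nhds.continuousAt
  have hc : φ =ᶠ[𝓝 0] fun _ => φ 0 := by
    filter_upwards [hmax, hmin] with t h h'
    exact le_antisymm h h'
  have e4 : deriv φ =ᶠ[𝓝 0] fun _ => 0 := by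
    filter_upwards [hc.eventuallyEq_nhds] with t ht
    rw [ht.deriv_eq]; simp
  rw [e4.deriv_eq] at e2
  simp at e2
  linarith

theorem eventually_line_mem {U : Set E3} (hU : IsOpen U) {y : E3} (hy : y ∈ U) (k : Fin 3) :
    ∀ᶠ t in 𝓝 (0 : ℝ), y + t • (EuclideanSpace.single k 1 : E3) ∈ U := by
  have hc : Continuous fun t : ℝ => y + t • (EuclideanSpace.single k 1 : E3) := by fun_prop
  exact hc.continuousAt.eventually_mem (hU.mem_nhds (by simpa using hy))

theorem hasDerivAt_along {f : E3 → ℝ} {y : E3} {k : Fin 3} {t : ℝ}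
    (hf : DifferentiableAt ℝ f (y + t • (EuclideanSpace.single k 1 : E3))) :
    HasDerivAt (fun t : ℝ => f (y + t • (EuclideanSpace.single k 1 : E3)))
      (partialD k f (y + t • (EuclideanSpace.single k 1 : E3))) t := by
  have h1 : HasDerivAt (fun t : ℝ => y + t • (EuclideanSpace.single k 1 : E3))
      (EuclideanSpace.single k 1) t := by
    simpa using ((hasDerivAt_id t).smul_const (EuclideanSpace.single k 1 : E3)).const_add y
  exact hf.hasFDerivAt.comp_hasDerivAt t h1

theorem hasDerivAt_along_zero {f : E3 → ℝ} {y : E3} {k : Fin 3} (hf : DifferentiableAt ℝ f y) :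
    HasDerivAt (fun t : ℝ => f (y + t • (EuclideanSpace.single k 1 : E3))) (partialD k f y) 0 := by
  have := hasDerivAt_along (f := f) (y := y) (k := k) (t := 0) (by simpa using hf)
  simpa using this

theorem partialD_eq_of_hasDerivAt {f : E3 → ℝ} {y : E3} {k : Fin 3} {d : ℝ}
    (hf : DifferentiableAt ℝ f y)
    (h : HasDerivAt (fun t : ℝ => f (y + t • (EuclideanSpace.single k 1 : E3))) d 0) :
    partialD k f y = d :=
  (hasDerivAt_along_zero hf).unique h

theorem eventually_hasDerivAt_along {U : Set E3} (hU : IsOpen U) {f : E3 → ℝ} {n : WithTop ℕ∞}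
    (hf : ContDiffOn ℝ n f U) (hn : n ≠ 0) {y : E3} (hy : y ∈ U) (k : Fin 3) :
    ∀ᶠ t in 𝓝 (0 : ℝ), HasDerivAt (fun t : ℝ => f (y + t • (EuclideanSpace.single k 1 : E3)))
      (partialD k f (y + t • (EuclideanSpace.single k 1 : E3))) t := by
  filter_upwards [eventually_line_mem hU hy k] with t ht
  exact hasDerivAt_along ((hf.contDiffAt (hU.mem_nhds ht)).differentiableAt hn)

theorem contDiffOn_partialD {U : Set E3} (hU : IsOpen U) {f : E3 → ℝ} (hf : ContDiffOn ℝ 2 f U)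
    (k : Fin 3) : ContDiffOn ℝ 1 (partialD k f) U := by
  have h1 : ContDiffOn ℝ 1 (fderiv ℝ f) U := hf.fderiv_of_isOpen hU (by norm_num)
  exact h1.clm_apply contDiffOn_const

theorem hasDerivAt_partialD_along {U : Set E3} (hU : IsOpen U) {f : E3 → ℝ}
    (hf : ContDiffOn ℝ 2 f U) {y : E3} (hy : y ∈ U) (k l : Fin 3) :
    HasDerivAt (fun t : ℝ => partialD l f (y + t • (EuclideanSpace.single k 1 : E3)))
      (partialD k (partialD l f) y) 0 :=
  hasDerivAt_along_zero (((contDiffOn_partialD hU hf l).contDiffAt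
    (hU.mem_nhds hy)).differentiableAt (by norm_num))

theorem partialD_comm {U : Set E3} (hU : IsOpen U) {f : E3 → ℝ} (hf : ContDiffOn ℝ 2 f U)
    {y : E3} (hy : y ∈ U) (k l : Fin 3) :
    partialD k (partialD l f) y = partialD l (partialD k f) y := by
  have hs : IsSymmSndFDerivAt ℝ f y :=
    (hf.contDiffAt (hU.mem_nhds hy)).isSymmSndFDerivAt (by simp)
  have hd : DifferentiableAt ℝ (fderiv ℝ f) y :=
    ((hf.fderiv_of_isOpen hU (m := 1) (by norm_num)).contDiffAt
      (hU.mem_nhds hy)).differentiableAt (by norm_num)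
  have key : ∀ a b : Fin 3, partialD a (partialD b f) y =
      fderiv ℝ (fderiv ℝ f) y (EuclideanSpace.single a 1) (EuclideanSpace.single b 1) := by
    intro a b
    have h := (hd.hasFDerivAt.clm_apply
      (hasFDerivAt_const (EuclideanSpace.single b 1 : E3) y)).fderiv
    unfold partialD
    rw [h]; simp
  rw [key, key]
  exact hs.eq _ _

theorem isOpen_Omega : IsOpen Omega := isOpen_lt continuous_const continuous_norm

theorem Omega_subset_OmegaBar : Omega ⊆ OmegaBar := fun _ hx => le_of_lt (by simpa [Omega] using hx)

theorem sum_coord_sq (x : E3) : ∑ i, x i ^ 2 = ‖x‖ ^ 2 := by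
  rw [EuclideanSpace.norm_sq_eq]; simp

theorem hasDerivAt_normSq_along (y : E3) (k : Fin 3) (t : ℝ) :
    HasDerivAt (fun t : ℝ => ‖y + t • (EuclideanSpace.single k 1 : E3)‖ ^ 2)
      (2 * (y k + t)) t := by
  have h : (fun t : ℝ => ‖y + t • (EuclideanSpace.single k 1 : E3)‖ ^ 2) =
      fun t => ‖y‖ ^ 2 + 2 * t * y k + t ^ 2 := by
    ext t
    rw [norm_add_sq_real, inner_smul_right, norm_smul]
    simp [EuclideanSpace.inner_single_right]
    ring
  rw [h]
  have h1 := (((hasDerivAt_id t).const_mul 2).mul_const (y k)).const_add (‖y‖ ^ 2)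
  have h2 := h1.add ((hasDerivAt_id t).pow 2)
  refine h2.congr_deriv ?_
  simp only [id]
  ring

theorem hasDerivAt_coord_along (y : E3) (i k : Fin 3) (t : ℝ) :
    HasDerivAt (fun t : ℝ => (y + t • (EuclideanSpace.single k 1 : E3)) i)
      (if i = k then 1 else 0) t := by
  have h : (fun t : ℝ => (y + t • (EuclideanSpace.single k 1 : E3)) i) =
      fun t => y i + t * (if i = k then 1 else 0) := by
    ext t; simp
  rw [h]
  simpa using ((hasDerivAt_id t).mul_const (if i = k then (1 : ℝ) else 0)).const_add (y i)

theorem nonpos_of_hasDerivWithinAt_Ici {φ : ℝ → ℝ} {d : ℝ}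
    (h : HasDerivWithinAt φ d (Ici 0) 0) (hmax : ∀ᶠ t in 𝓝[>] (0 : ℝ), φ t ≤ φ 0) : d ≤ 0 := by
  rw [← hasDerivWithinAt_Ioi_iff_Ici, hasDerivWithinAt_iff_tendsto_slope' (by simp)] at h
  refine le_of_tendsto h ?_
  filter_upwards [hmax, self_mem_nhdsWithin] with t ht (ht0 : 0 < t)
  rw [slope_def_field]
  exact div_nonpos_of_nonpos_of_nonneg (by linarith) (by linarith)

theorem isCompact_annulus (R : ℝ) : IsCompact {x : E3 | 1 ≤ ‖x‖ ∧ ‖x‖ ≤ R} := by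
  refine (isCompact_closedBall (0 : E3) R).of_isClosed_subset ?_ ?_
  · exact (isClosed_le continuous_const continuous_norm).inter
      (isClosed_le continuous_norm continuous_const)
  · intro x hx; simpa using hx.2

theorem norm_add_smul_self {x : E3} (hx : ‖x‖ = 1) {t : ℝ} (ht : 0 ≤ t) : ‖x + t • x‖ = 1 + t := by
  have : x + t • x = (1 + t) • x := by rw [add_smul, one_smul]
  rw [this, norm_smul, hx, Real.norm_of_nonneg (by linarith), mul_one]

theorem hasDerivAt_normSq_radial {x : E3} (hx : ‖x‖ = 1) :
    HasDerivWithinAt (fun t : ℝ => ‖x + t • x‖ ^ 2) 2 (Ici 0) 0 := by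
  have h : HasDerivAt (fun t : ℝ => (1 + t) ^ 2) 2 0 := by
    exact (((hasDerivAt_id (0 : ℝ)).const_add 1).fun_pow 2).congr_deriv (by norm_num)
  refine h.hasDerivWithinAt.congr (fun t ht => ?_) (by simp [hx])
  rw [norm_add_smul_self hx ht]

theorem eventually_norm_radial_lt {x : E3} {R : ℝ} (hx : ‖x‖ = 1) (hR : 1 < R) :
    ∀ᶠ t in 𝓝[>] (0 : ℝ), 1 ≤ ‖x + t • x‖ ∧ ‖x + t • x‖ < R := by
  have h : ∀ᶠ t in 𝓝 (0 : ℝ), t < R - 1 := eventually_lt_nhds (by linarith)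
  filter_upwards [h.filter_mono nhdsWithin_le_nhds, self_mem_nhdsWithin] with t ht (ht0 : 0 < t)
  rw [norm_add_smul_self hx ht0.le]
  constructor <;> linarith

/-- Comparison principle on the annulus `1 ≤ |x| ≤ R` with a Robin condition on `|x| = 1`. -/
theorem robin_comparison {v : E3 → ℝ} {w N ε R : ℝ} (hw : 0 < w) (hN : 0 < N) (hε : 0 ≤ ε)
    (hR : 1 < R) (hcont : ContinuousOn v OmegaBar) (hv : ContDiffOn ℝ 2 v Omega)
    (hlap : ∀ x ∈ Omega, ‖x‖ < R → -N ≤ ∑ k, partialD k (partialD k v) x)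
    (hbc : ∀ x, ‖x‖ = 1 → HasDerivWithinAt (fun t : ℝ => v (x + t • x)) (w * v x) (Ici 0) 0)
    (hout : ∀ x, ‖x‖ = R → v x ≤ ε) {x : E3} (hx1 : 1 ≤ ‖x‖) (hxR : ‖x‖ ≤ R) :
    v x ≤ ε + N * R ^ 2 := by
  have hc : ContinuousOn (fun x => v x + N * ‖x‖ ^ 2) {x : E3 | 1 ≤ ‖x‖ ∧ ‖x‖ ≤ R} :=
    (hcont.mono fun y hy => hy.1).add (by fun_prop)
  obtain ⟨y, ⟨hy1, hyR⟩, hmax⟩ := (isCompact_annulus R).exists_isMaxOn ⟨x, hx1, hxR⟩ hc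
  have hxy : v x + N * ‖x‖ ^ 2 ≤ v y + N * ‖y‖ ^ 2 := hmax ⟨hx1, hxR⟩
  have hx0 : 0 ≤ N * ‖x‖ ^ 2 := by positivity
  rcases eq_or_lt_of_le hyR with hyR | hyR
  · have := hout y hyR
    rw [hyR] at hxy
    linarith
  rcases eq_or_lt_of_le hy1 with hy1 | hy1
  · have h1 : HasDerivWithinAt (fun t : ℝ => v (y + t • y) + N * ‖y + t • y‖ ^ 2)
        (w * v y + N * 2) (Ici 0) 0 :=
      (hbc y hy1.symm).add ((hasDerivAt_normSq_radial hy1.symm).const_mul N)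
    have h2 := nonpos_of_hasDerivWithinAt_Ici h1 (by
      filter_upwards [eventually_norm_radial_lt hy1.symm hR] with t ht
      simpa using hmax (⟨ht.1, ht.2.le⟩ : y + t • y ∈ {x : E3 | 1 ≤ ‖x‖ ∧ ‖x‖ ≤ R}))
    have h3 : v y ≤ 0 := by
      by_contra! h
      have := mul_pos hw h
      linarith
    rw [← hy1] at hxy
    have : N * 1 ^ 2 ≤ N * R ^ 2 := by gcongr
    linarith
  · exfalso
    have hyO : y ∈ Omega := hy1
    have key : ∀ k, partialD k (partialD k v) y + N * 2 ≤ 0 := by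
      intro k
      have hU : IsOpen (Omega ∩ {x : E3 | ‖x‖ < R}) :=
        isOpen_Omega.inter (isOpen_lt continuous_norm continuous_const)
      refine second_deriv_nonpos_of_isLocalMax
        (φ := fun t : ℝ => v (y + t • (EuclideanSpace.single k 1 : E3)) +
          N * ‖y + t • (EuclideanSpace.single k 1 : E3)‖ ^ 2)
        (φ' := fun t : ℝ => partialD k v (y + t • (EuclideanSpace.single k 1 : E3)) +
          N * (2 * (y k + t))) ?_ ?_ ?_
      · filter_upwards [eventually_line_mem hU ⟨hyO, hyR⟩ k] with t ht
        simpa using hmax (⟨le_of_lt ht.1, le_of_lt ht.2⟩ : _ ∈ {x : E3 | 1 ≤ ‖x‖ ∧ ‖x‖ ≤ R})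
      · filter_upwards [eventually_hasDerivAt_along isOpen_Omega hv (by norm_num) hyO k] with t ht
        exact ht.add ((hasDerivAt_normSq_along y k t).const_mul N)
      · refine (hasDerivAt_partialD_along isOpen_Omega hv hyO k k).add ?_
        have := (((hasDerivAt_id (0 : ℝ)).const_add (y k)).const_mul 2).const_mul N
        simpa using this
    have hs : ∑ k, (partialD k (partialD k v) y + N * 2) ≤ 0 :=
      Finset.sum_nonpos fun k _ => key k
    rw [Finset.sum_add_distrib] at hs
    have := hlap y hyO hyR
    simp at hs
    linarith

set_option maxHeartbeats 400000 in
/-- A Keller–Osserman type bound in the exterior domain, without conditions at infinity. -/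
theorem keller_osserman_bound {g : E3 → ℝ} {w κ m : ℝ} (hw : 0 < w) (hκ : 0 < κ) (hm : 0 ≤ m)
    (hcont : ContinuousOn g OmegaBar) (hg : ContDiffOn ℝ 2 g Omega)
    (hlap : ∀ x ∈ Omega, κ * (g x ^ 2 - m ^ 2) ≤ ∑ k, partialD k (partialD k g) x)
    (hbc : ∀ x, ‖x‖ = 1 → ∃ d, w * (g x - m) ≤ d ∧
      HasDerivWithinAt (fun t : ℝ => g (x + t • x)) d (Ici 0) 0)
    {x : E3} (hx1 : 1 ≤ ‖x‖) : g x ≤ m := by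
  have main : ∀ T : ℝ, ‖x‖ ^ 2 < T → 4 < w * (T - 1) →
      (g x - m) * (T - ‖x‖ ^ 2) ^ 2 ≤ 36 * T / κ := by
    intro T hT hwT
    have hT1 : 1 < T := by nlinarith
    obtain ⟨R, hR, rfl⟩ : ∃ R : ℝ, 1 < R ∧ R ^ 2 = T :=
      ⟨√T, by rw [Real.lt_sqrt (by norm_num)]; linarith, Real.sq_sqrt (by linarith)⟩
    have hxR : ‖x‖ < R := by
      by_contra! h
      nlinarith
    have hc : ContinuousOn (fun x => (g x - m) * (R ^ 2 - ‖x‖ ^ 2) ^ 2)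
        {x : E3 | 1 ≤ ‖x‖ ∧ ‖x‖ ≤ R} :=
      ((hcont.mono fun y hy => hy.1).sub continuousOn_const).mul (by fun_prop)
    obtain ⟨y, ⟨hy1, hyR⟩, hmax⟩ := (isCompact_annulus R).exists_isMaxOn ⟨x, hx1, hxR.le⟩ hc
    have hxy : (g x - m) * (R ^ 2 - ‖x‖ ^ 2) ^ 2 ≤ (g y - m) * (R ^ 2 - ‖y‖ ^ 2) ^ 2 :=
      hmax ⟨hx1, hxR.le⟩
    refine hxy.trans ?_
    by_contra! hP
    set P := (g y - m) * (R ^ 2 - ‖y‖ ^ 2) ^ 2 with hPdef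
    have hP0 : 0 < P := lt_trans (by positivity) hP
    have hyR : ‖y‖ < R := by
      refine lt_of_le_of_ne hyR fun h => ?_
      rw [h] at hPdef
      simp at hPdef
      linarith
    have hpos : ∀ z : E3, ‖z‖ < R → 0 < R ^ 2 - ‖z‖ ^ 2 := fun z hz => by
      have := norm_nonneg z
      nlinarith
    have hle : ∀ z : E3, 1 ≤ ‖z‖ → ‖z‖ < R → g z - P * ((R ^ 2 - ‖z‖ ^ 2) ^ 2)⁻¹ ≤ m := by
      intro z hz1 hzR
      have h1 : (g z - m) * (R ^ 2 - ‖z‖ ^ 2) ^ 2 ≤ P := hmax ⟨hz1, hzR.le⟩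
      have h2 := hpos z hzR
      have := (le_div_iff₀ (by positivity : 0 < (R ^ 2 - ‖z‖ ^ 2) ^ 2)).2 h1
      rw [div_eq_mul_inv] at this
      linarith
    have hs := hpos y hyR
    have heq : g y - P * ((R ^ 2 - ‖y‖ ^ 2) ^ 2)⁻¹ = m := by
      rw [hPdef]; field_simp; ring
    set s := R ^ 2 - ‖y‖ ^ 2 with hsdef
    have hgy : g y - m = P * (s ^ 2)⁻¹ := by linarith
    rcases eq_or_lt_of_le hy1 with hy1 | hy1
    · obtain ⟨d, hd, hder⟩ := hbc y hy1.symm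
      have h0 : R ^ 2 - ‖y + (0 : ℝ) • y‖ ^ 2 = s := by simp [hsdef]
      have h1 := (((hasDerivAt_normSq_radial hy1.symm).const_sub (R ^ 2)).fun_pow 2).fun_inv
        (by rw [h0]; positivity)
      have h2 := hder.sub (h1.const_mul P)
      have h3 := nonpos_of_hasDerivWithinAt_Ici h2 (by
        filter_upwards [eventually_norm_radial_lt hy1.symm hR] with t ht
        have := hle _ ht.1 ht.2
        simp only [Pi.sub_apply, zero_smul, add_zero]
        rw [← hsdef, heq]
        exact this)
      rw [h0] at h3
      have h4 : d ≤ 4 * P * (s ^ 3)⁻¹ := by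
        have : P * (-(((2 : ℕ) : ℝ) * s ^ (2 - 1) * -2) / (s ^ 2) ^ 2) = 4 * P * (s ^ 3)⁻¹ := by
          field_simp; norm_num; ring
        linarith
      have h5 : w * (P * (s ^ 2)⁻¹) ≤ 4 * P * (s ^ 3)⁻¹ := by rw [← hgy]; exact hd.trans h4
      have h6 : w * s ≤ 4 := by
        have e1 : w * (P * (s ^ 2)⁻¹) = (w * s) * (P * (s ^ 3)⁻¹) := by field_simp
        have e2 : 4 * P * (s ^ 3)⁻¹ = 4 * (P * (s ^ 3)⁻¹) := by ring
        rw [e1, e2] at h5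
        exact le_of_mul_le_mul_right h5 (by positivity)
      rw [hsdef, ← hy1] at h6
      norm_num at h6
      linarith
    · have hyO : y ∈ Omega := hy1
      have key : ∀ k, partialD k (partialD k g) y - P * (4 * (s ^ 3)⁻¹ + 24 * y k ^ 2 * (s ^ 4)⁻¹)
          ≤ 0 := by
        intro k
        have hU : IsOpen (Omega ∩ {x : E3 | ‖x‖ < R}) :=
          isOpen_Omega.inter (isOpen_lt continuous_norm continuous_const)
        have hsd : ∀ t : ℝ, HasDerivAt
            (fun t : ℝ => R ^ 2 - ‖y + t • (EuclideanSpace.single k 1 : E3)‖ ^ 2)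
            (-(2 * (y k + t))) t := fun t => (hasDerivAt_normSq_along y k t).const_sub _
        have h0 : R ^ 2 - ‖y + (0 : ℝ) • (EuclideanSpace.single k 1 : E3)‖ ^ 2 = s := by
          simp [hsdef]
        refine second_deriv_nonpos_of_isLocalMax
          (φ := fun t : ℝ => g (y + t • (EuclideanSpace.single k 1 : E3)) -
            P * ((R ^ 2 - ‖y + t • (EuclideanSpace.single k 1 : E3)‖ ^ 2) ^ 2)⁻¹)
          (φ' := fun t : ℝ => partialD k g (y + t • (EuclideanSpace.single k 1 : E3)) -
            P * (4 * (y k + t) *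
              ((R ^ 2 - ‖y + t • (EuclideanSpace.single k 1 : E3)‖ ^ 2) ^ 3)⁻¹)) ?_ ?_ ?_
        · filter_upwards [eventually_line_mem hU ⟨hyO, hyR⟩ k] with t ht
          have := hle _ (le_of_lt ht.1) ht.2
          simp only [zero_smul, add_zero]
          rw [← hsdef, heq]
          exact this
        · filter_upwards [eventually_hasDerivAt_along isOpen_Omega hg (by norm_num) hyO k,
            eventually_line_mem hU ⟨hyO, hyR⟩ k] with t ht htU
          have hp := hpos _ htU.2
          refine ht.sub ?_
          have := (((hsd t).fun_pow 2).fun_inv (by positivity)).const_mul P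
          refine this.congr_deriv ?_
          field_simp
          norm_num
          ring
        · refine (hasDerivAt_partialD_along isOpen_Omega hg hyO k k).sub ?_
          have h1 := ((hsd 0).fun_pow 3).fun_inv (by rw [h0]; positivity)
          have h2 := ((((hasDerivAt_id (0 : ℝ)).const_add (y k)).const_mul 4).mul h1).const_mul P
          refine h2.congr_deriv ?_
          simp only [h0, id, add_zero]
          push_cast
          field_simp
          ring
      have hsum : ∑ k, (partialD k (partialD k g) y -
          P * (4 * (s ^ 3)⁻¹ + 24 * y k ^ 2 * (s ^ 4)⁻¹)) ≤ 0 :=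
        Finset.sum_nonpos fun k _ => key k
      have hr2 := sum_coord_sq y
      rw [Finset.sum_sub_distrib, ← Finset.mul_sum, Finset.sum_add_distrib, ← Finset.sum_mul,
        ← Finset.sum_mul, ← Finset.mul_sum, hr2] at hsum
      have hl := hlap y hyO
      have h1 : κ * (P * (s ^ 2)⁻¹) ^ 2 ≤ P * (12 * (s ^ 3)⁻¹ + 24 * ‖y‖ ^ 2 * (s ^ 4)⁻¹) := by
        have e1 : κ * (P * (s ^ 2)⁻¹) ^ 2 ≤ κ * (g y ^ 2 - m ^ 2) := by
          have : 0 < P * (s ^ 2)⁻¹ := by positivity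
          refine mul_le_mul_of_nonneg_left ?_ hκ.le
          rw [← hgy]
          nlinarith
        simp at hsum
        linarith
      have h2 : κ * P ≤ 12 * s + 24 * ‖y‖ ^ 2 := by
        have e1 : κ * (P * (s ^ 2)⁻¹) ^ 2 = (κ * P) * (P * (s ^ 4)⁻¹) := by field_simp
        have e2 : P * (12 * (s ^ 3)⁻¹ + 24 * ‖y‖ ^ 2 * (s ^ 4)⁻¹) =
            (12 * s + 24 * ‖y‖ ^ 2) * (P * (s ^ 4)⁻¹) := by field_simp
        rw [e1, e2] at h1
        exact le_of_mul_le_mul_right h1 (by positivity)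
      rw [div_lt_iff₀ hκ] at hP
      nlinarith [sq_nonneg ‖y‖]
  by_contra! hlt
  have hδ : 0 < g x - m := by linarith
  set T := 2 * ‖x‖ ^ 2 + 145 / (κ * (g x - m)) + 4 / w + 1 with hTdef
  have hp1 : 0 < 145 / (κ * (g x - m)) := by positivity
  have hp2 : 0 < 4 / w := by positivity
  have hp3 : 0 ≤ ‖x‖ ^ 2 := by positivity
  have h1 := main T (by linarith) (by
    have : 4 / w < T - 1 := by nlinarith
    rw [div_lt_iff₀ hw] at this
    linarith)
  have hT0 : 0 < T := by linarith
  have h2 : (T / 2) ^ 2 ≤ (T - ‖x‖ ^ 2) ^ 2 := by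
    apply pow_le_pow_left₀ (by linarith); linarith
  have h3 : (g x - m) * (T / 2) ^ 2 ≤ 36 * T / κ :=
    (mul_le_mul_of_nonneg_left h2 hδ.le).trans h1
  rw [le_div_iff₀ hκ] at h3
  have h4 : 145 / (κ * (g x - m)) ≤ T := by linarith
  rw [div_le_iff₀ (by positivity)] at h4
  nlinarith

/-- Reflection of `ℝ³` in the `k`-th coordinate. -/
def reflect (k : Fin 3) (z : E3) : E3 := z - (2 * z k) • (EuclideanSpace.single k 1 : E3)

theorem reflect_apply (k i : Fin 3) (z : E3) : reflect k z i = if i = k then -z i else z i := by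
  by_cases h : i = k
  · subst h; simp [reflect]; ring
  · simp [reflect, h]

theorem norm_reflect_sq (k : Fin 3) (z : E3) : ‖reflect k z‖ ^ 2 = ‖z‖ ^ 2 := by
  rw [← sum_coord_sq, ← sum_coord_sq]
  refine Finset.sum_congr rfl fun i _ => ?_
  rw [reflect_apply]; split_ifs <;> ring

theorem continuous_reflect (k : Fin 3) : Continuous (reflect k) := by
  unfold reflect; fun_prop

theorem reflect_line (k i : Fin 3) (z : E3) (t : ℝ) :
    reflect k (z + t • (EuclideanSpace.single i 1 : E3)) =
      reflect k z + ((if i = k then -1 else 1) * t) • (EuclideanSpace.single i 1 : E3) := by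
  ext j
  simp only [reflect_apply, PiLp.add_apply, PiLp.smul_apply, smul_eq_mul]
  by_cases h1 : i = k <;> by_cases h2 : j = k <;> by_cases h3 : j = i <;> simp [h1, h2, h3] <;>
    ring

/-- The half cube used in the reflection argument. -/
def halfCube (k : Fin 3) (d : ℝ) : Set E3 := {z | (∀ i, |z i| ≤ d) ∧ 0 ≤ z k}

theorem norm_lt_of_coord_le {z : E3} {d : ℝ} (hd : 0 < d) (h : ∀ i, |z i| ≤ d) : ‖z‖ < 2 * d := by
  have h1 : ‖z‖ ^ 2 ≤ 3 * d ^ 2 := by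
    rw [← sum_coord_sq, Fin.sum_univ_three]
    have h2 : ∀ i, z i ^ 2 ≤ d ^ 2 := fun i => by
      rw [← sq_abs]; exact pow_le_pow_left₀ (abs_nonneg _) (h i) 2
    linarith [h2 0, h2 1, h2 2]
  nlinarith [norm_nonneg z]

theorem isCompact_halfCube {k : Fin 3} {d : ℝ} (hd : 0 < d) : IsCompact (halfCube k d) := by
  refine (isCompact_closedBall (0 : E3) (2 * d)).of_isClosed_subset ?_ ?_
  · have h1 : IsClosed {z : E3 | ∀ i, |z i| ≤ d} := by
      rw [Set.ofPred_forall]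
      exact isClosed_iInter fun i => isClosed_le (by fun_prop) continuous_const
    exact h1.inter (isClosed_le continuous_const (by fun_prop : Continuous fun z : E3 => z k))
  · intro z hz
    simpa using (norm_lt_of_coord_le hd hz.1).le

/-- Barrier for the gradient estimate. -/
def gradBarrier (k : Fin 3) (d M N : ℝ) (z : E3) : ℝ :=
  M / d ^ 2 * (‖z‖ ^ 2 + 3 * (d * z k - z k ^ 2)) + N / 2 * (d * z k - z k ^ 2)

theorem gradBarrier_nonneg {k : Fin 3} {d M N : ℝ} (hM : 0 ≤ M) (hN : 0 ≤ N) {z : E3}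
    (hz : z ∈ halfCube k d) : 0 ≤ gradBarrier k d M N z := by
  have h1 : 0 ≤ d * z k - z k ^ 2 := by nlinarith [hz.2, le_of_abs_le (hz.1 k)]
  unfold gradBarrier
  positivity

theorem le_gradBarrier {k : Fin 3} {d M N : ℝ} (hd : 0 < d) (hM : 0 ≤ M) (hN : 0 ≤ N) {z : E3}
    (hz : z ∈ halfCube k d) {i : Fin 3} (hi : |z i| = d) : M ≤ gradBarrier k d M N z := by
  have h1 : 0 ≤ d * z k - z k ^ 2 := by nlinarith [hz.2, le_of_abs_le (hz.1 k)]
  have h2 : d ^ 2 ≤ ‖z‖ ^ 2 := by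
    rw [← sum_coord_sq, ← hi, sq_abs]
    exact Finset.single_le_sum (f := fun i => z i ^ 2) (fun i _ => sq_nonneg _) (Finset.mem_univ i)
  unfold gradBarrier
  have h3 : M = M / d ^ 2 * d ^ 2 := by field_simp
  have h4 : M / d ^ 2 * d ^ 2 ≤ M / d ^ 2 * (‖z‖ ^ 2 + 3 * (d * z k - z k ^ 2)) := by
    apply mul_le_mul_of_nonneg_left _ (by positivity); linarith
  have h5 : 0 ≤ N / 2 * (d * z k - z k ^ 2) := by positivity
  linarith

/-- First derivative of `gradBarrier` along the `i`-th coordinate line. -/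
def gradBarrierDeriv (k : Fin 3) (d M N : ℝ) (i : Fin 3) (z : E3) (t : ℝ) : ℝ :=
  M / d ^ 2 * (2 * (z i + t) + 3 * ((d - 2 * (z + t • (EuclideanSpace.single i 1 : E3)) k) *
    (if k = i then 1 else 0))) + N / 2 * ((d - 2 * (z + t • (EuclideanSpace.single i 1 : E3)) k) *
    (if k = i then 1 else 0))

theorem hasDerivAt_gradBarrier (k : Fin 3) (d M N : ℝ) (i : Fin 3) (z : E3) (t : ℝ) :
    HasDerivAt (fun t : ℝ => gradBarrier k d M N (z + t • (EuclideanSpace.single i 1 : E3)))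
      (gradBarrierDeriv k d M N i z t) t := by
  unfold gradBarrier gradBarrierDeriv
  have h1 := hasDerivAt_normSq_along z i t
  have h2 := hasDerivAt_coord_along z k i t
  have h3 := (h2.const_mul d).fun_sub (h2.fun_pow 2)
  refine (((h1.fun_add (h3.const_mul 3)).const_mul (M / d ^ 2)).fun_add
    (h3.const_mul (N / 2))).congr_deriv ?_
  push_cast
  ring

theorem hasDerivAt_gradBarrierDeriv (k : Fin 3) (d M N : ℝ) (i : Fin 3) (z : E3) :
    HasDerivAt (gradBarrierDeriv k d M N i z)
      (2 * (M / d ^ 2) - (6 * (M / d ^ 2) + N) * (if k = i then 1 else 0)) 0 := by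
  unfold gradBarrierDeriv
  have h1 := ((hasDerivAt_id (0 : ℝ)).const_add (z i)).const_mul 2
  have h2 := hasDerivAt_coord_along z k i 0
  have h3 := ((h2.const_mul 2).const_sub d).mul_const (if k = i then (1 : ℝ) else 0)
  refine (((h1.fun_add (h3.const_mul 3)).const_mul (M / d ^ 2)).fun_add
    (h3.const_mul (N / 2))).congr_deriv ?_
  split_ifs <;> ring

theorem hasDerivAt_reflect {f g : ℝ → ℝ} {s b : ℝ} {x : ℝ} (hf : HasDerivAt f b (s * x))
    (hg : ∀ t, g t = f (s * t)) : HasDerivAt g (s * b) x := by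
  have h1 : HasDerivAt (fun t : ℝ => s * t) s x := by
    simpa using (hasDerivAt_id x).const_mul s
  have : g = f ∘ fun t => s * t := funext hg
  rw [this, mul_comm]
  exact hf.comp x h1

theorem half_diff_le_gradBarrier {v : E3 → ℝ} {x₀ : E3} {d M N : ℝ} (k : Fin 3) (hd : 0 < d)
    (hv : ContDiffOn ℝ 2 v (ball x₀ (2 * d))) (hM : ∀ y ∈ ball x₀ (2 * d), |v y| ≤ M)
    (hN : ∀ y ∈ ball x₀ (2 * d), |∑ k, partialD k (partialD k v) y| < N) {z : E3}
    (hz : z ∈ halfCube k d) :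
    (v (x₀ + z) - v (x₀ + reflect k z)) / 2 ≤ gradBarrier k d M N z := by
  have hx₀ : x₀ ∈ ball x₀ (2 * d) := mem_ball_self (by positivity)
  have hM0 : 0 ≤ M := (abs_nonneg _).trans (hM x₀ hx₀)
  have hN0 : 0 ≤ N := (abs_nonneg _).trans (hN x₀ hx₀).le
  have hnr : ∀ z, ‖reflect k z‖ = ‖z‖ := fun z => by
    have := norm_reflect_sq k z
    exact (pow_left_inj₀ (norm_nonneg _) (norm_nonneg _) two_ne_zero).1 this
  have hb1 : ∀ z ∈ halfCube k d, x₀ + z ∈ ball x₀ (2 * d) := fun z hz => by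
    simpa using norm_lt_of_coord_le hd hz.1
  have hb2 : ∀ z ∈ halfCube k d, x₀ + reflect k z ∈ ball x₀ (2 * d) := fun z hz => by
    simpa [hnr] using norm_lt_of_coord_le hd hz.1
  have hcr := continuous_reflect k
  have hcb : Continuous (gradBarrier k d M N) := by unfold gradBarrier; fun_prop
  have hc : ContinuousOn (fun z => (v (x₀ + z) - v (x₀ + reflect k z)) / 2 -
      gradBarrier k d M N z) (halfCube k d) := by
    refine ContinuousOn.sub (ContinuousOn.div_const (ContinuousOn.sub ?_ ?_) _) hcb.continuousOn
    · exact hv.continuousOn.comp (by fun_prop) hb1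
    · exact hv.continuousOn.comp (by fun_prop) hb2
  obtain ⟨y, hy, hmax⟩ := (isCompact_halfCube hd).exists_isMaxOn ⟨z, hz⟩ hc
  have hzy : (v (x₀ + z) - v (x₀ + reflect k z)) / 2 - gradBarrier k d M N z ≤
    (v (x₀ + y) - v (x₀ + reflect k y)) / 2 - gradBarrier k d M N y := hmax hz
  suffices h : (v (x₀ + y) - v (x₀ + reflect k y)) / 2 - gradBarrier k d M N y ≤ 0 by linarith
  have hvM : (v (x₀ + y) - v (x₀ + reflect k y)) / 2 ≤ M := by
    have h1 := abs_le.1 (hM _ (hb1 y hy))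
    have h2 := abs_le.1 (hM _ (hb2 y hy))
    linarith [h1.2, h2.1]
  by_cases hbd : ∃ i, |y i| = d
  · obtain ⟨i, hi⟩ := hbd
    have := le_gradBarrier hd hM0 hN0 hy hi
    linarith
  rcases eq_or_lt_of_le hy.2 with hk | hk
  · have : reflect k y = y := by
      ext i; rw [reflect_apply]; split_ifs with h
      · rw [h, ← hk]; simp
      · rfl
    have := gradBarrier_nonneg hM0 hN0 hy
    rw [‹reflect k y = y›]
    linarith
  exfalso
  push Not at hbd
  have hU : IsOpen {z : E3 | (∀ i, |z i| < d) ∧ 0 < z k} := by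
    have h1 : IsOpen {z : E3 | ∀ i, |z i| < d} := by
      rw [Set.ofPred_forall]
      exact isOpen_iInter_of_finite fun i => isOpen_lt (by fun_prop) continuous_const
    exact h1.inter (isOpen_lt continuous_const (by fun_prop : Continuous fun z : E3 => z k))
  have hyU : y ∈ {z : E3 | (∀ i, |z i| < d) ∧ 0 < z k} :=
    ⟨fun i => lt_of_le_of_ne (hy.1 i) (hbd i), hk⟩
  have key : ∀ i, (partialD i (partialD i v) (x₀ + y) -
      partialD i (partialD i v) (x₀ + reflect k y)) / 2 -
      (2 * (M / d ^ 2) - (6 * (M / d ^ 2) + N) * (if k = i then 1 else 0)) ≤ 0 := by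
    intro i
    set s : ℝ := if i = k then -1 else 1 with hs
    have hss : s * s = 1 := by rw [hs]; split_ifs <;> norm_num
    have hr : ∀ t : ℝ, x₀ + reflect k (y + t • (EuclideanSpace.single i 1 : E3)) =
        (x₀ + reflect k y) + (s * t) • (EuclideanSpace.single i 1 : E3) := fun t => by
      rw [reflect_line, add_assoc]
    refine second_deriv_nonpos_of_isLocalMax
      (φ := fun t : ℝ => (v (x₀ + y + t • (EuclideanSpace.single i 1 : E3)) -
        v (x₀ + reflect k (y + t • (EuclideanSpace.single i 1 : E3)))) / 2 -
        gradBarrier k d M N (y + t • (EuclideanSpace.single i 1 : E3)))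
      (φ' := fun t : ℝ => (partialD i v (x₀ + y + t • (EuclideanSpace.single i 1 : E3)) -
        s * partialD i v (x₀ + reflect k y + (s * t) • (EuclideanSpace.single i 1 : E3))) / 2 -
        gradBarrierDeriv k d M N i y t) ?_ ?_ ?_
    · filter_upwards [eventually_line_mem hU hyU i] with t ht
      have := hmax (⟨fun j => (ht.1 j).le, ht.2.le⟩ :
        y + t • (EuclideanSpace.single i 1 : E3) ∈ halfCube k d)
      simp only [zero_smul, add_zero]
      rw [add_assoc]
      exact this
    · have hst : Tendsto (fun t : ℝ => s * t) (𝓝 0) (𝓝 0) := by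
        have : Continuous fun t : ℝ => s * t := by fun_prop
        simpa using this.tendsto 0
      filter_upwards [eventually_hasDerivAt_along isOpen_ball hv (by norm_num) (hb1 y hy) i,
        hst.eventually (eventually_hasDerivAt_along isOpen_ball hv (by norm_num) (hb2 y hy) i)]
        with t h1 h2
      refine ((h1.fun_sub ?_).div_const 2).fun_sub (hasDerivAt_gradBarrier k d M N i y t)
      exact hasDerivAt_reflect h2 fun t => by rw [hr]
    · have h1 := hasDerivAt_partialD_along isOpen_ball hv (hb1 y hy) i i
      have h2 := hasDerivAt_partialD_along isOpen_ball hv (hb2 y hy) i i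
      have h3 : HasDerivAt (fun t : ℝ =>
          partialD i v (x₀ + reflect k y + (s * t) • (EuclideanSpace.single i 1 : E3)))
          (s * partialD i (partialD i v) (x₀ + reflect k y)) 0 :=
        hasDerivAt_reflect (by simpa using h2) fun t => rfl
      refine (((h1.fun_sub (h3.const_mul s)).div_const 2).fun_sub
        (hasDerivAt_gradBarrierDeriv k d M N i y)).congr_deriv ?_
      rw [← mul_assoc, hss, one_mul]
  have hsum := Finset.sum_nonpos fun i (_ : i ∈ Finset.univ) => key i
  rw [Finset.sum_sub_distrib, ← Finset.sum_div, Finset.sum_sub_distrib,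
    Finset.sum_sub_distrib, ← Finset.mul_sum, ← Finset.mul_sum, Finset.sum_ite_eq] at hsum
  simp at hsum
  have h1 := (abs_lt.1 (hN _ (hb1 y hy))).1
  have h2 := (abs_lt.1 (hN _ (hb2 y hy))).2
  linarith

theorem partialD_le_of_ball {v : E3 → ℝ} {x₀ : E3} {d M N : ℝ} (k : Fin 3) (hd : 0 < d)
    (hv : ContDiffOn ℝ 2 v (ball x₀ (2 * d))) (hM : ∀ y ∈ ball x₀ (2 * d), |v y| ≤ M)
    (hN : ∀ y ∈ ball x₀ (2 * d), |∑ k, partialD k (partialD k v) y| < N) :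
    partialD k v x₀ ≤ 3 * M / d + d / 2 * N := by
  have hdiff : DifferentiableAt ℝ v x₀ :=
    (hv.contDiffAt (isOpen_ball.mem_nhds (mem_ball_self (by positivity)))).differentiableAt
      (by norm_num)
  have h1 := hasDerivAt_along_zero (k := k) hdiff
  have hrefl : ∀ t : ℝ, reflect k (t • (EuclideanSpace.single k 1 : E3)) =
      (-1 * t) • (EuclideanSpace.single k 1 : E3) := fun t => by
    have h0 : reflect k 0 = 0 := by simp [reflect]
    simpa [h0] using reflect_line k k 0 t
  have h2 : HasDerivAt (fun t : ℝ => v (x₀ + reflect k (t • (EuclideanSpace.single k 1 : E3))))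
      (-1 * partialD k v x₀) 0 :=
    hasDerivAt_reflect (f := fun t : ℝ => v (x₀ + t • (EuclideanSpace.single k 1 : E3)))
      (by simpa using h1) fun t => by rw [hrefl]
  have h3 := hasDerivAt_gradBarrier k d M N k 0 0
  have h4 := nonpos_of_hasDerivWithinAt_Ici
    (((h1.fun_sub h2).div_const 2).fun_sub h3).hasDerivWithinAt (by
      filter_upwards [(eventually_lt_nhds hd).filter_mono nhdsWithin_le_nhds,
        self_mem_nhdsWithin] with t ht (ht0 : 0 < t)
      have hmem : t • (EuclideanSpace.single k 1 : E3) ∈ halfCube k d := by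
        refine ⟨fun i => ?_, by simpa using ht0.le⟩
        by_cases h : i = k
        · subst h; simp [abs_of_pos ht0, ht.le]
        · simp [h, hd.le]
      have := half_diff_le_gradBarrier k hd hv hM hN hmem
      have e0 : gradBarrier k d M N 0 = 0 := by simp [gradBarrier]
      have e1 : reflect k 0 = 0 := by simp [reflect]
      simp [e0, e1]
      linarith)
  simp [gradBarrierDeriv] at h4
  have e : M / d ^ 2 * (3 * d) = 3 * M / d := by field_simp
  linarith

theorem abs_partialD_le_of_ball {v : E3 → ℝ} {x₀ : E3} {d M N : ℝ} (k : Fin 3) (hd : 0 < d)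
    (hv : ContDiffOn ℝ 2 v (ball x₀ (2 * d))) (hM : ∀ y ∈ ball x₀ (2 * d), |v y| ≤ M)
    (hN : ∀ y ∈ ball x₀ (2 * d), |∑ k, partialD k (partialD k v) y| < N) :
    |partialD k v x₀| ≤ 3 * M / d + d / 2 * N := by
  have hneg : ∀ (k : Fin 3) (f : E3 → ℝ), partialD k (fun x => -f x) = fun x => -partialD k f x :=
    fun k f => by
      ext x; unfold partialD; rw [fderiv_fun_neg]; rfl
  refine abs_le'.2 ⟨partialD_le_of_ball k hd hv hM hN, ?_⟩
  have := partialD_le_of_ball (v := fun x => -v x) k hd hv.neg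
    (fun y hy => by rw [abs_neg]; exact hM y hy) (fun y hy => by
      simp only [hneg, Finset.sum_neg_distrib, abs_neg]; exact hN y hy)
  simpa [hneg] using this

theorem integral_partialD_eq_zero {f : E3 → ℝ} (hf : ContDiff ℝ 1 f) (hc : HasCompactSupport f)
    (k : Fin 3) : ∫ x, partialD k f x = 0 := by
  have h1 : Continuous (partialD k f) := (hf.continuous_fderiv (by norm_num)).clm_apply
    continuous_const
  have h2 : HasCompactSupport (partialD k f) := by
    have := hc.fderiv_apply (𝕜 := ℝ) (EuclideanSpace.single k 1 : E3)
    exact this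
  have hI1 : Integrable (partialD k f) := h1.integrable_of_hasCompactSupport h2
  have hI2 : Integrable f := hf.continuous.integrable_of_hasCompactSupport hc
  have := integral_mul_fderiv_eq_neg_fderiv_mul_of_integrable (𝕜 := ℝ) (μ := (volume : Measure E3))
    (f := fun _ => (1 : ℝ)) (g := f) (v := EuclideanSpace.single k 1) (by simp)
    (by simp only [one_mul]; exact hI1) (by simpa using hI2) (fun x _ => by fun_prop)
    (fun x _ => hf.differentiable (by norm_num) x)
  simpa [partialD] using this

theorem exists_bound_deriv_smoothTransition :
    ∃ C : ℝ, 0 ≤ C ∧ ∀ t, |deriv smoothTransition t| ≤ C := by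
  have hc : Continuous (deriv smoothTransition) :=
    (smoothTransition.contDiff (n := 1)).continuous_deriv (by norm_num)
  have h0 : ∀ t : ℝ, t < 0 → deriv smoothTransition t = 0 := fun t ht => by
    have : smoothTransition =ᶠ[𝓝 t] fun _ => 0 := by
      filter_upwards [eventually_lt_nhds ht] with s hs
      exact smoothTransition.zero_of_nonpos hs.le
    rw [this.deriv_eq]; simp
  have h1 : ∀ t : ℝ, 1 < t → deriv smoothTransition t = 0 := fun t ht => by
    have : smoothTransition =ᶠ[𝓝 t] fun _ => 1 := by
      filter_upwards [eventually_gt_nhds ht] with s hs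
      exact smoothTransition.one_of_one_le hs.le
    rw [this.deriv_eq]; simp
  obtain ⟨C, hC⟩ := (isCompact_Icc (a := (0 : ℝ)) (b := 1)).exists_bound_of_continuousOn
    hc.continuousOn
  refine ⟨max C 0, le_max_right _ _, fun t => ?_⟩
  by_cases h : t ∈ Icc (0 : ℝ) 1
  · exact (hC t h).trans (le_max_left _ _)
  · rw [mem_Icc, not_and_or, not_le, not_le] at h
    rcases h with h | h
    · simp [h0 t h]
    · simp [h1 t h]

theorem deriv_smoothTransition_of_neg {t : ℝ} (ht : t < 0) : deriv smoothTransition t = 0 := by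
  have : smoothTransition =ᶠ[𝓝 t] fun _ => 0 := by
    filter_upwards [eventually_lt_nhds ht] with s hs
    exact smoothTransition.zero_of_nonpos hs.le
  rw [this.deriv_eq]; simp

theorem deriv_smoothTransition_of_one_lt {t : ℝ} (ht : 1 < t) : deriv smoothTransition t = 0 := by
  have : smoothTransition =ᶠ[𝓝 t] fun _ => 1 := by
    filter_upwards [eventually_gt_nhds ht] with s hs
    exact smoothTransition.one_of_one_le hs.le
  rw [this.deriv_eq]; simp

/-- Radial cutoff vanishing for `|x|² ≤ 2` and equal to one for `|x|² ≥ 3`. -/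
def innerCutoff (x : E3) : ℝ := smoothTransition (‖x‖ ^ 2 - 2)

/-- Radial cutoff equal to one for `|x| ≤ R` and vanishing for `|x|² ≥ 2R²`. -/
def outerCutoff (R : ℝ) (x : E3) : ℝ := 1 - smoothTransition (‖x‖ ^ 2 / R ^ 2 - 1)

theorem contDiff_innerCutoff : ContDiff ℝ 1 innerCutoff :=
  smoothTransition.contDiff.comp ((contDiff_norm_sq ℝ).sub contDiff_const)

theorem contDiff_outerCutoff (R : ℝ) : ContDiff ℝ 1 (outerCutoff R) :=
  contDiff_const.sub (smoothTransition.contDiff.comp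
    (((contDiff_norm_sq ℝ).div_const _).sub contDiff_const))

theorem innerCutoff_nonneg (x : E3) : 0 ≤ innerCutoff x := smoothTransition.nonneg _

theorem innerCutoff_le_one (x : E3) : innerCutoff x ≤ 1 := smoothTransition.le_one _

theorem innerCutoff_eq_one {x : E3} (hx : 3 ≤ ‖x‖ ^ 2) : innerCutoff x = 1 :=
  smoothTransition.one_of_one_le (by linarith)

theorem innerCutoff_eq_zero {x : E3} (hx : ‖x‖ ^ 2 ≤ 2) : innerCutoff x = 0 :=
  smoothTransition.zero_of_nonpos (by linarith)

theorem partialD_innerCutoff (j : Fin 3) (x : E3) :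
    partialD j innerCutoff x = deriv smoothTransition (‖x‖ ^ 2 - 2) * (2 * x j) := by
  refine partialD_eq_of_hasDerivAt (contDiff_innerCutoff.differentiable (by norm_num) x) ?_
  have h1 := (hasDerivAt_normSq_along x j 0).sub_const 2
  have h2 : HasDerivAt smoothTransition (deriv smoothTransition (‖x‖ ^ 2 - 2))
      (‖x + (0 : ℝ) • (EuclideanSpace.single j 1 : E3)‖ ^ 2 - 2) := by
    rw [zero_smul, add_zero]
    exact ((smoothTransition.contDiff (n := 1)).differentiable (by norm_num) _).hasDerivAt
  exact (h2.comp 0 h1).congr_deriv (by rw [add_zero])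

theorem partialD_outerCutoff (R : ℝ) (j : Fin 3) (x : E3) : partialD j (outerCutoff R) x =
    -(deriv smoothTransition (‖x‖ ^ 2 / R ^ 2 - 1) * (2 * x j / R ^ 2)) := by
  refine partialD_eq_of_hasDerivAt ((contDiff_outerCutoff R).differentiable (by norm_num) x) ?_
  have h1 := ((hasDerivAt_normSq_along x j 0).div_const (R ^ 2)).sub_const 1
  have h2 : HasDerivAt smoothTransition (deriv smoothTransition (‖x‖ ^ 2 / R ^ 2 - 1))
      (‖x + (0 : ℝ) • (EuclideanSpace.single j 1 : E3)‖ ^ 2 / R ^ 2 - 1) := by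
    rw [zero_smul, add_zero]
    exact ((smoothTransition.contDiff (n := 1)).differentiable (by norm_num) _).hasDerivAt
  exact ((h2.comp 0 h1).const_sub 1).congr_deriv (by rw [add_zero])

theorem abs_coord_le_norm (x : E3) (j : Fin 3) : |x j| ≤ ‖x‖ := PiLp.norm_apply_le x j

theorem abs_partialD_innerCutoff_le {C : ℝ} (hC : ∀ t, |deriv smoothTransition t| ≤ C)
    (j : Fin 3) (x : E3) : |partialD j innerCutoff x| ≤ C * (2 * ‖x‖) := by
  rw [partialD_innerCutoff, abs_mul, abs_mul, abs_two]
  exact mul_le_mul (hC _) (by gcongr; exact abs_coord_le_norm x j) (by positivity)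
    ((abs_nonneg _).trans (hC 0))

theorem abs_partialD_outerCutoff_le {C R : ℝ} (hC : ∀ t, |deriv smoothTransition t| ≤ C)
    (hR : 0 < R) (j : Fin 3) {x : E3} (hx : 0 < ‖x‖) :
    |partialD j (outerCutoff R) x| ≤ 4 * C / ‖x‖ := by
  have hC0 : 0 ≤ C := (abs_nonneg _).trans (hC 0)
  rw [partialD_outerCutoff, abs_neg]
  by_cases h : 1 < ‖x‖ ^ 2 / R ^ 2 - 1
  · rw [deriv_smoothTransition_of_one_lt h, zero_mul, abs_zero]; positivity
  · have h1 : ‖x‖ ^ 2 ≤ 2 * R ^ 2 := by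
      rw [← div_le_iff₀ (by positivity)]; linarith
    have h2 : |2 * x j / R ^ 2| ≤ 4 / ‖x‖ := by
      rw [abs_div, abs_mul, abs_two, abs_of_pos (by positivity : 0 < R ^ 2),
        div_le_div_iff₀ (by positivity) hx]
      nlinarith [abs_coord_le_norm x j]
    rw [abs_mul]
    calc _ ≤ C * (4 / ‖x‖) := mul_le_mul (hC _) h2 (abs_nonneg _) hC0
      _ = _ := by ring

theorem partialD_innerCutoff_eq_zero {x : E3} (hx : ‖x‖ ^ 2 < 2 ∨ 3 < ‖x‖ ^ 2) (j : Fin 3) :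
    partialD j innerCutoff x = 0 := by
  rw [partialD_innerCutoff]
  rcases hx with hx | hx
  · rw [deriv_smoothTransition_of_neg (by linarith), zero_mul]
  · rw [deriv_smoothTransition_of_one_lt (by linarith), zero_mul]

theorem norm_mem_of_partialD_innerCutoff_ne_zero {x : E3} {j : Fin 3}
    (h : partialD j innerCutoff x ≠ 0) : 2 ≤ ‖x‖ ^ 2 ∧ ‖x‖ ^ 2 ≤ 3 := by
  by_contra h'
  rw [not_and_or, not_le, not_le] at h'
  exact h (partialD_innerCutoff_eq_zero h' j)

theorem partialD_mul {f g : E3 → ℝ} {x : E3} (hf : DifferentiableAt ℝ f x)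
    (hg : DifferentiableAt ℝ g x) (j : Fin 3) :
    partialD j (fun x => f x * g x) x = f x * partialD j g x + partialD j f x * g x := by
  unfold partialD
  rw [fderiv_fun_mul hf hg]
  simp; ring

theorem cutoff_mul_eventually_eq_zero {G : E3 → ℝ} {R : ℝ} {x : E3} (hx : x ∉ Omega) :
    (fun x => innerCutoff x * outerCutoff R x * G x) =ᶠ[𝓝 x] fun _ => 0 := by
  have h1 : ‖x‖ ^ 2 < 2 := by
    have : ‖x‖ ≤ 1 := not_lt.1 hx
    nlinarith [norm_nonneg x]
  have : Continuous fun x : E3 => ‖x‖ ^ 2 := by fun_prop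
  filter_upwards [this.continuousAt.eventually_lt_const h1] with y hy
  rw [innerCutoff_eq_zero hy.le]; simp

theorem contDiff_cutoff_mul {G : E3 → ℝ} (hG : ContDiffOn ℝ 1 G Omega) (R : ℝ) :
    ContDiff ℝ 1 fun x => innerCutoff x * outerCutoff R x * G x := by
  rw [contDiff_iff_contDiffAt]
  intro x
  by_cases hx : x ∈ Omega
  · exact (contDiff_innerCutoff.contDiffAt.mul (contDiff_outerCutoff R).contDiffAt).mul
      (hG.contDiffAt (isOpen_Omega.mem_nhds hx))
  · exact contDiffAt_const.congr_of_eventuallyEq (cutoff_mul_eventually_eq_zero hx)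

theorem hasCompactSupport_cutoff_mul (G : E3 → ℝ) {R : ℝ} (hR : 0 < R) :
    HasCompactSupport fun x => innerCutoff x * outerCutoff R x * G x := by
  refine HasCompactSupport.of_support_subset_isCompact (isCompact_closedBall (0 : E3) (2 * R)) ?_
  intro x hx
  by_contra h
  have h1 : 2 * R < ‖x‖ := by simpa using h
  apply hx
  have h2 : 1 ≤ ‖x‖ ^ 2 / R ^ 2 - 1 := by
    rw [le_sub_iff_add_le, le_div_iff₀ (by positivity)]
    nlinarith
  simp [outerCutoff, smoothTransition.one_of_one_le h2]

/-- The divergence of a vector field on `ℝ³`. -/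
def divergence (G : Fin 3 → E3 → ℝ) (x : E3) : ℝ := ∑ j, partialD j (G j) x

theorem partialD_cutoff_mul {G : E3 → ℝ} (hG : ContDiffOn ℝ 1 G Omega) (R : ℝ) (j : Fin 3)
    {x : E3} (hx : x ∈ Omega) :
    partialD j (fun x => innerCutoff x * outerCutoff R x * G x) x =
      outerCutoff R x * (innerCutoff x * partialD j G x + partialD j innerCutoff x * G x) +
        innerCutoff x * partialD j (outerCutoff R) x * G x := by
  have h1 := contDiff_innerCutoff.differentiable (by norm_num) x
  have h2 := (contDiff_outerCutoff R).differentiable (by norm_num) x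
  have h3 := (hG.contDiffAt (isOpen_Omega.mem_nhds hx)).differentiableAt (by norm_num)
  rw [partialD_mul (h1.fun_mul h2) h3, partialD_mul h1 h2]
  ring

theorem eventually_outerCutoff (x : E3) :
    ∀ᶠ n : ℕ in atTop, outerCutoff (n + 1) x = 1 ∧
      ∀ j, partialD j (outerCutoff (n + 1)) x = 0 := by
  have h : ∀ᶠ n : ℕ in atTop, ‖x‖ ≤ n := tendsto_natCast_atTop_atTop.eventually_ge_atTop _
  filter_upwards [h] with n hn
  have h1 : ‖x‖ ^ 2 / ((n : ℝ) + 1) ^ 2 - 1 < 0 := by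
    rw [sub_neg, div_lt_one (by positivity)]
    have := norm_nonneg x
    nlinarith
  refine ⟨by simp [outerCutoff, smoothTransition.zero_of_nonpos h1.le], fun j => ?_⟩
  rw [partialD_outerCutoff, deriv_smoothTransition_of_neg h1]
  simp

theorem outerCutoff_mem (R : ℝ) (x : E3) : |outerCutoff R x| ≤ 1 := by
  have h1 := smoothTransition.nonneg (‖x‖ ^ 2 / R ^ 2 - 1)
  have h2 := smoothTransition.le_one (‖x‖ ^ 2 / R ^ 2 - 1)
  unfold outerCutoff
  rw [abs_le]; constructor <;> linarith

/-- Divergence theorem in the exterior domain for fields decaying at infinity in an integral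
sense, localized away from the unit sphere. -/
theorem integral_divergence_cutoff {G : Fin 3 → E3 → ℝ} (hG : ∀ j, ContDiffOn ℝ 1 (G j) Omega)
    (hdecay : ∀ j, IntegrableOn (fun x => G j x / ‖x‖) Omega)
    (hInt : IntegrableOn (fun x => innerCutoff x * divergence G x +
      ∑ j, partialD j innerCutoff x * G j x) Omega) :
    ∫ x in Omega, (innerCutoff x * divergence G x + ∑ j, partialD j innerCutoff x * G j x) = 0 := by
  obtain ⟨C, hC0, hC⟩ := exists_bound_deriv_smoothTransition
  set f : ℕ → E3 → ℝ := fun n x =>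
    ∑ j, partialD j (fun x => innerCutoff x * outerCutoff (n + 1) x * G j x) x with hf
  have hcont : ∀ (n : ℕ) j, Continuous
      (partialD j (fun x => innerCutoff x * outerCutoff (n + 1) x * G j x)) := fun n j =>
    ((contDiff_cutoff_mul (hG j) _).continuous_fderiv (by norm_num)).clm_apply continuous_const
  have hzero : ∀ n, ∫ x in Omega, f n x = 0 := by
    intro n
    have hn : (0 : ℝ) < n + 1 := by positivity
    rw [setIntegral_eq_integral_of_forall_compl_eq_zero]
    · rw [hf, integral_finsetSum]
      · exact Finset.sum_eq_zero fun j _ => integral_partialD_eq_zero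
          (contDiff_cutoff_mul (hG j) _) (hasCompactSupport_cutoff_mul (G j) hn) j
      · intro j _
        refine (hcont n j).integrable_of_hasCompactSupport ?_
        exact (hasCompactSupport_cutoff_mul (G j) hn).fderiv_apply (𝕜 := ℝ) _
    · intro x hx
      refine Finset.sum_eq_zero fun j _ => ?_
      unfold partialD
      rw [(cutoff_mul_eventually_eq_zero (G := G j) hx).fderiv_eq]
      simp
  have hexp : ∀ n, ∀ x ∈ Omega, f n x = outerCutoff (n + 1) x * (innerCutoff x * divergence G x +
      ∑ j, partialD j innerCutoff x * G j x) +
      ∑ j, innerCutoff x * partialD j (outerCutoff (n + 1)) x * G j x := by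
    intro n x hx
    simp only [hf, divergence]
    rw [Finset.sum_congr rfl fun j _ => partialD_cutoff_mul (hG j) _ j hx, Finset.sum_add_distrib,
      ← Finset.mul_sum, Finset.sum_add_distrib, Finset.mul_sum (f := fun j => partialD j (G j) x)]
  have hlim : Tendsto (fun n => ∫ x in Omega, f n x) atTop (𝓝 (∫ x in Omega,
      (innerCutoff x * divergence G x + ∑ j, partialD j innerCutoff x * G j x))) := by
    refine tendsto_integral_of_dominated_convergence
      (fun x => ‖innerCutoff x * divergence G x + ∑ j, partialD j innerCutoff x * G j x‖ +
        ∑ j, 4 * C * ‖G j x / ‖x‖‖) ?_ ?_ ?_ ?_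
    · intro n
      exact (continuous_finsetSum _ fun j _ => hcont n j).aestronglyMeasurable
    · exact hInt.norm.add (integrable_finsetSum _ fun j _ => (hdecay j).norm.const_mul _)
    · intro n
      refine ae_restrict_of_forall_mem isOpen_Omega.measurableSet fun x hx => ?_
      rw [hexp n x hx]
      have hx0 : 0 < ‖x‖ := lt_trans one_pos hx
      refine (norm_add_le _ _).trans (add_le_add ?_ ((norm_sum_le _ _).trans ?_))
      · rw [norm_mul]
        exact mul_le_of_le_one_left (norm_nonneg _) (outerCutoff_mem _ _)
      · refine Finset.sum_le_sum fun j _ => ?_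
        rw [norm_mul, norm_mul, norm_div, norm_norm]
        have h1 : ‖innerCutoff x‖ ≤ 1 := by
          rw [Real.norm_of_nonneg (innerCutoff_nonneg x)]; exact innerCutoff_le_one x
        have h2 : ‖partialD j (outerCutoff (n + 1)) x‖ ≤ 4 * C / ‖x‖ :=
          abs_partialD_outerCutoff_le hC (by positivity) j hx0
        calc _ ≤ 1 * (4 * C / ‖x‖) * ‖G j x‖ := by gcongr
          _ = _ := by ring
    · refine ae_restrict_of_forall_mem isOpen_Omega.measurableSet fun x hx => ?_
      refine tendsto_const_nhds.congr' ?_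
      filter_upwards [eventually_outerCutoff x] with n hn
      rw [hexp n x hx, hn.1]
      simp [hn.2]
  simp only [hzero] at hlim
  exact (tendsto_nhds_unique hlim tendsto_const_nhds)

theorem exists_abs_integral_cutoff_divergence_le : ∃ K : ℝ, 0 ≤ K ∧
    ∀ (G : Fin 3 → E3 → ℝ) (C : ℝ), (∀ j, ContDiffOn ℝ 1 (G j) Omega) →
      (∀ j, IntegrableOn (fun x => G j x / ‖x‖) Omega) →
      IntegrableOn (fun x => innerCutoff x * divergence G x) Omega →
      (∀ j x, 2 ≤ ‖x‖ ^ 2 → ‖x‖ ^ 2 ≤ 3 → |G j x| ≤ C) →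
      |∫ x in Omega, innerCutoff x * divergence G x| ≤ K * C := by
  obtain ⟨D, hD0, hD⟩ := exists_bound_deriv_smoothTransition
  refine ⟨(volume.restrict Omega).real (ball (0 : E3) 2) * (3 * (4 * D)), by positivity, ?_⟩
  intro G C hG hdecay hInt hbd
  have hC0 : 0 ≤ C := by
    have hn : ‖(EuclideanSpace.single 0 (3 / 2 : ℝ) : E3)‖ = 3 / 2 := by
      rw [PiLp.norm_single]; norm_num
    exact (abs_nonneg _).trans (hbd 0 (EuclideanSpace.single 0 (3 / 2 : ℝ)) (by rw [hn]; norm_num)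
      (by rw [hn]; norm_num))
  set h : E3 → ℝ := fun x => ∑ j, partialD j innerCutoff x * G j x with hh
  set g : E3 → ℝ := (ball (0 : E3) 2).indicator fun _ => 3 * (4 * D) * C with hg
  have hgi : IntegrableOn g Omega := by
    have : IntegrableOn g univ := by
      rw [integrableOn_univ, hg, integrable_indicator_iff measurableSet_ball]
      exact integrableOn_const measure_ball_lt_top.ne
    exact this.mono_set (subset_univ _)
  have hle : ∀ x, ‖h x‖ ≤ g x := by
    intro x
    by_cases hx : 2 ≤ ‖x‖ ^ 2 ∧ ‖x‖ ^ 2 ≤ 3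
    · have hx2 : ‖x‖ < 2 := by nlinarith [norm_nonneg x, hx.2]
      have hm : x ∈ ball (0 : E3) 2 := by simpa using hx2
      rw [hg, indicator_of_mem hm]
      refine (norm_sum_le _ _).trans ?_
      have : ∀ j, ‖partialD j innerCutoff x * G j x‖ ≤ 4 * D * C := fun j => by
        rw [norm_mul]
        have h1 : ‖partialD j innerCutoff x‖ ≤ 4 * D :=
          (abs_partialD_innerCutoff_le hD j x).trans (by nlinarith)
        exact mul_le_mul h1 (hbd j x hx.1 hx.2) (norm_nonneg _) (by positivity)
      calc _ ≤ ∑ _j : Fin 3, 4 * D * C := Finset.sum_le_sum fun j _ => this j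
        _ = _ := by simp; ring
    · have h0 : h x = 0 := by
        refine Finset.sum_eq_zero fun j _ => ?_
        have : partialD j innerCutoff x = 0 := by
          by_contra h0
          exact hx (norm_mem_of_partialD_innerCutoff_ne_zero h0)
        rw [this, zero_mul]
      rw [h0, norm_zero]
      exact indicator_nonneg (fun _ _ => by positivity) x
  have hmeas : AEStronglyMeasurable h (volume.restrict Omega) := by
    refine ContinuousOn.aestronglyMeasurable ?_ isOpen_Omega.measurableSet
    refine continuousOn_finsetSum _ fun j _ => ContinuousOn.mul ?_ (hG j).continuousOn
    exact ((contDiff_innerCutoff.continuous_fderiv (by norm_num)).clm_apply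
      continuous_const).continuousOn
  have hhi : IntegrableOn h Omega := hgi.mono' hmeas (ae_of_all _ hle)
  have hsum := integral_divergence_cutoff hG hdecay (hInt.add hhi)
  rw [integral_add hInt hhi] at hsum
  have h1 : |∫ x in Omega, h x| ≤ ∫ x in Omega, g x :=
    norm_integral_le_of_norm_le hgi (ae_of_all _ hle)
  have h2 : ∫ x in Omega, g x = (volume.restrict Omega).real (ball (0 : E3) 2) *
      (3 * (4 * D)) * C := by
    rw [hg, integral_indicator_const _ measurableSet_ball, smul_eq_mul]
    ring
  rw [eq_neg_of_add_eq_zero_left hsum, abs_neg, ← h2]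
  exact h1

/-- The Dirichlet density `∑ₐ |∇qₐ|²`. -/
def dirichletDensity {ι : Type*} [Fintype ι] (q : ι → E3 → ℝ) (x : E3) : ℝ :=
  ∑ a, ∑ k, partialD k (q a) x ^ 2

theorem dirichletDensity_nonneg {ι : Type*} [Fintype ι] (q : ι → E3 → ℝ) (x : E3) :
    0 ≤ dirichletDensity q x :=
  Finset.sum_nonneg fun _ _ => Finset.sum_nonneg fun _ _ => sq_nonneg _

theorem contDiff_coord (j : Fin 3) : ContDiff ℝ 1 fun x : E3 => x j := by fun_prop

theorem integrableOn_innerCutoff_mul {f : E3 → ℝ} (hf : IntegrableOn f Omega) :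
    IntegrableOn (fun x => innerCutoff x * f x) Omega := by
  refine Integrable.bdd_mul (c := 1) hf contDiff_innerCutoff.continuous.aestronglyMeasurable ?_
  refine ae_of_all _ fun x => ?_
  rw [Real.norm_of_nonneg (innerCutoff_nonneg x)]
  exact innerCutoff_le_one x

/-- The vector field whose divergence gives the Pohozaev identity. -/
def pohozaevField {ι : Type*} [Fintype ι] (q : ι → E3 → ℝ) (F : E3 → ℝ) (j : Fin 3) (x : E3) : ℝ :=
  ∑ a, partialD j (q a) x * ∑ k, x k * partialD k (q a) x -
    x j * ((∑ a, ∑ k, partialD k (q a) x ^ 2) / 2 + F x)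

theorem contDiffOn_pohozaevField {ι : Type*} [Fintype ι] {q : ι → E3 → ℝ} {F : E3 → ℝ}
    (hq : ∀ a, ContDiffOn ℝ 2 (q a) Omega) (hF : ContDiffOn ℝ 1 F Omega) (j : Fin 3) :
    ContDiffOn ℝ 1 (pohozaevField q F j) Omega := by
  have h := fun a k => contDiffOn_partialD isOpen_Omega (hq a) k
  refine ContDiffOn.sub (ContDiffOn.sum fun a _ => (h a j).mul (ContDiffOn.sum fun k _ =>
    (contDiff_coord k).contDiffOn.mul (h a k))) ((contDiff_coord j).contDiffOn.mul ?_)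
  exact ((ContDiffOn.sum fun a _ => ContDiffOn.sum fun k _ => (h a k).pow 2).div_const _).add hF

theorem sum_sub_rearrange {ι : Type*} [Fintype ι] {A B D : Fin 3 → ι → ℝ} {S : ι → ℝ} {F : ℝ}
    {x : Fin 3 → ℝ}
    (h : ∀ a, ∑ j, (A j a - (S a / 2 + x j * (B j a / 2 + D j a))) = -(S a / 2)) :
    ∑ j, (∑ a, A j a - (1 * ((∑ a, S a) / 2 + F) + x j * ((∑ a, B j a) / 2 + ∑ a, D j a))) =
      -((∑ a, S a) / 2 + 3 * F) := by
  have h' := Finset.sum_congr (rfl : (Finset.univ : Finset ι) = Finset.univ) fun a _ => h a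
  rw [Finset.sum_comm] at h'
  simp only [Finset.sum_sub_distrib, Finset.sum_add_distrib, ← Finset.mul_sum, ← Finset.sum_div,
    Finset.sum_neg_distrib, Fin.sum_univ_three] at h' ⊢
  linarith

theorem divergence_pohozaevField {ι : Type*} [Fintype ι] {q : ι → E3 → ℝ} {F : E3 → ℝ}
    (hq : ∀ a, ContDiffOn ℝ 2 (q a) Omega) (hF : ContDiffOn ℝ 1 F Omega)
    (hgrad : ∀ x ∈ Omega, ∀ j, partialD j F x =
      ∑ a, (∑ k, partialD k (partialD k (q a)) x) * partialD j (q a) x)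
    {x : E3} (hx : x ∈ Omega) :
    divergence (pohozaevField q F) x = -(dirichletDensity q x / 2 + 3 * F x) := by
  have key : ∀ j, partialD j (pohozaevField q F j) x =
      ∑ a, (partialD j (partialD j (q a)) x * ∑ k, x k * partialD k (q a) x +
        partialD j (q a) x * ∑ k, ((if k = j then 1 else 0) * partialD k (q a) x +
          x k * partialD j (partialD k (q a)) x)) -
      (1 * ((∑ a, ∑ k, partialD k (q a) x ^ 2) / 2 + F x) + x j *
        ((∑ a, ∑ k, 2 * partialD k (q a) x * partialD j (partialD k (q a)) x) / 2 +
          partialD j F x)) := by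
    intro j
    refine partialD_eq_of_hasDerivAt (((contDiffOn_pohozaevField hq hF j).contDiffAt
      (isOpen_Omega.mem_nhds hx)).differentiableAt (by norm_num)) ?_
    have hP := fun a k => hasDerivAt_partialD_along isOpen_Omega (hq a) hx j k
    have hX := fun k => hasDerivAt_coord_along x k j 0
    have hF' := hasDerivAt_along_zero (k := j) ((hF.contDiffAt
      (isOpen_Omega.mem_nhds hx)).differentiableAt (by norm_num))
    have h1 := HasDerivAt.fun_sum (u := Finset.univ) fun a _ => (hP a j).fun_mul
      (HasDerivAt.fun_sum (u := Finset.univ) fun k _ => (hX k).fun_mul (hP a k))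
    have h2 := (hX j).fun_mul (((HasDerivAt.fun_sum (u := Finset.univ) fun a _ =>
      HasDerivAt.fun_sum (u := Finset.univ) fun k _ => (hP a k).fun_pow 2).div_const 2).fun_add hF')
    refine (h1.fun_sub h2).congr_deriv ?_
    simp
  have hsymm := fun a k l => partialD_comm isOpen_Omega (hq a) hx k l
  have hpoint : ∀ a, ∑ j, (partialD j (partialD j (q a)) x * ∑ k, x k * partialD k (q a) x +
      partialD j (q a) x * ∑ k, ((if k = j then 1 else 0) * partialD k (q a) x +
        x k * partialD j (partialD k (q a)) x) - ((∑ k, partialD k (q a) x ^ 2) / 2 +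
      x j * ((∑ k, 2 * partialD k (q a) x * partialD j (partialD k (q a)) x) / 2 +
        (∑ k, partialD k (partialD k (q a)) x) * partialD j (q a) x))) =
      -((∑ k, partialD k (q a) x ^ 2) / 2) := by
    intro a
    simp only [Fin.sum_univ_three]
    rw [hsymm a 1 0, hsymm a 2 0, hsymm a 2 1]
    simp
    ring
  have hsum := sum_sub_rearrange (F := F x) (x := fun j => x j) hpoint
  rw [divergence, Finset.sum_congr rfl fun j _ => key j]
  simp only [hgrad x hx]
  exact hsum

theorem abs_pohozaevField_le {ι : Type*} [Fintype ι] (q : ι → E3 → ℝ) {F : E3 → ℝ} {x : E3}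
    (hF : 0 ≤ F x) (j : Fin 3) :
    |pohozaevField q F j x| ≤ ‖x‖ * (4 * dirichletDensity q x + F x) := by
  have hS := dirichletDensity_nonneg q x
  have h1 : |∑ a, partialD j (q a) x * ∑ k, x k * partialD k (q a) x| ≤
      ‖x‖ * (3 * dirichletDensity q x) := by
    refine (Finset.abs_sum_le_sum_abs _ _).trans ?_
    rw [dirichletDensity, Finset.mul_sum, Finset.mul_sum]
    refine Finset.sum_le_sum fun a _ => ?_
    set s := ∑ k, partialD k (q a) x ^ 2 with hs
    have hle : ∀ k, partialD k (q a) x ^ 2 ≤ s := fun k =>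
      Finset.single_le_sum (f := fun k => partialD k (q a) x ^ 2) (fun _ _ => sq_nonneg _)
        (Finset.mem_univ k)
    rw [Finset.mul_sum]
    refine (Finset.abs_sum_le_sum_abs _ _).trans ?_
    have : ∀ k, |partialD j (q a) x * (x k * partialD k (q a) x)| ≤ ‖x‖ * s := by
      intro k
      rw [abs_mul, abs_mul]
      have e1 : |partialD j (q a) x| * |partialD k (q a) x| ≤ s := by
        have h1 := hle j
        have h2 := hle k
        rw [← sq_abs] at h1 h2
        nlinarith [sq_nonneg (|partialD j (q a) x| - |partialD k (q a) x|)]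
      calc _ = |x k| * (|partialD j (q a) x| * |partialD k (q a) x|) := by ring
        _ ≤ _ := mul_le_mul (abs_coord_le_norm x k) e1 (by positivity) (norm_nonneg _)
    calc _ ≤ ∑ _k : Fin 3, ‖x‖ * s := Finset.sum_le_sum fun k _ => this k
      _ = _ := by simp; ring
  have h2 : |x j * ((∑ a, ∑ k, partialD k (q a) x ^ 2) / 2 + F x)| ≤
      ‖x‖ * (dirichletDensity q x / 2 + F x) := by
    rw [abs_mul]
    have : 0 ≤ (∑ a, ∑ k, partialD k (q a) x ^ 2) / 2 + F x := by
      have : 0 ≤ (∑ a, ∑ k, partialD k (q a) x ^ 2) := hS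
      positivity
    rw [abs_of_nonneg this]
    exact mul_le_mul_of_nonneg_right (abs_coord_le_norm x j) this
  refine (abs_sub _ _).trans ?_
  nlinarith [norm_nonneg x, mul_nonneg (norm_nonneg x) hS]

/-- Pohozaev estimate: away from the unit sphere, the Dirichlet energy of a finite-energy solution
of `Δ q = ∇F(q)` is controlled by its local energy density near the sphere. -/
theorem exists_pohozaev_bound : ∃ K : ℝ, 0 ≤ K ∧
    ∀ {ι : Type} [Fintype ι] (q : ι → E3 → ℝ) (F : E3 → ℝ) (C : ℝ),
      (∀ a, ContDiffOn ℝ 2 (q a) Omega) → ContDiffOn ℝ 1 F Omega → (∀ x ∈ Omega, 0 ≤ F x) →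
      (∀ x ∈ Omega, ∀ j, partialD j F x =
        ∑ a, (∑ k, partialD k (partialD k (q a)) x) * partialD j (q a) x) →
      IntegrableOn (dirichletDensity q) Omega → IntegrableOn F Omega →
      (∀ x, 2 ≤ ‖x‖ ^ 2 → ‖x‖ ^ 2 ≤ 3 → dirichletDensity q x ≤ C ∧ F x ≤ C) →
      ∫ x in Omega, innerCutoff x * dirichletDensity q x ≤ K * C := by
  obtain ⟨K, hK0, hK⟩ := exists_abs_integral_cutoff_divergence_le
  refine ⟨20 * K, by positivity, ?_⟩
  intro ι _ q F C hq hF hF0 hgrad hSi hFi hbd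
  have hcd := contDiffOn_pohozaevField hq hF
  have hdiv : EqOn (fun x => innerCutoff x * divergence (pohozaevField q F) x)
      (fun x => innerCutoff x * -(dirichletDensity q x / 2 + 3 * F x)) Omega := fun x hx => by
    simp only [divergence_pohozaevField hq hF hgrad hx]
  have hi1 : IntegrableOn (fun x => dirichletDensity q x / 2 + 3 * F x) Omega :=
    (hSi.div_const 2).add (hFi.const_mul 3)
  have h := hK (pohozaevField q F) (10 * C) hcd ?_ ?_ ?_
  · rw [setIntegral_congr_fun isOpen_Omega.measurableSet hdiv] at h
    have h1 : ∫ x in Omega, innerCutoff x * dirichletDensity q x ≤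
        ∫ x in Omega, -2 * (innerCutoff x * -(dirichletDensity q x / 2 + 3 * F x)) := by
      refine setIntegral_mono_on (integrableOn_innerCutoff_mul hSi)
        ((integrableOn_innerCutoff_mul hi1.neg).const_mul _) isOpen_Omega.measurableSet ?_
      intro x hx
      have := mul_nonneg (innerCutoff_nonneg x) (hF0 x hx)
      nlinarith
    rw [integral_const_mul] at h1
    have := (abs_le.1 h).1
    linarith
  · intro j
    have hdom : IntegrableOn (fun x => 4 * dirichletDensity q x + F x) Omega :=
      (hSi.const_mul 4).add hFi
    refine Integrable.mono' hdom ?_ ?_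
    · refine ContinuousOn.aestronglyMeasurable ?_ isOpen_Omega.measurableSet
      refine (hcd j).continuousOn.div continuous_norm.continuousOn fun x hx => ?_
      exact (lt_trans one_pos hx).ne'
    · refine ae_restrict_of_forall_mem isOpen_Omega.measurableSet fun x hx => ?_
      rw [norm_div, norm_norm, div_le_iff₀ (lt_trans one_pos hx), mul_comm]
      exact abs_pohozaevField_le q (hF0 x hx) j
  · exact (integrableOn_innerCutoff_mul hi1.neg).congr_fun hdiv.symm isOpen_Omega.measurableSet
  · intro j x h2 h3
    have hx : x ∈ Omega := show 1 < ‖x‖ by nlinarith [norm_nonneg x]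
    refine (abs_pohozaevField_le q (hF0 x hx) j).trans ?_
    have hx2 : ‖x‖ ≤ 2 := by nlinarith [norm_nonneg x]
    obtain ⟨hb1, hb2⟩ := hbd x h2 h3
    have := dirichletDensity_nonneg q x
    have := hF0 x hx
    calc _ ≤ 2 * (4 * dirichletDensity q x + F x) := by gcongr
      _ ≤ _ := by linarith

/-- The vector field `|u|² x / |x|²` used in the proof of the Hardy inequality. -/
def hardyField {ι : Type*} [Fintype ι] (u : ι → E3 → ℝ) (j : Fin 3) (x : E3) : ℝ :=
  (∑ a, u a x ^ 2) * (x j * (‖x‖ ^ 2)⁻¹)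

theorem contDiffOn_hardyField {ι : Type*} [Fintype ι] {u : ι → E3 → ℝ}
    (hu : ∀ a, ContDiffOn ℝ 1 (u a) Omega) (j : Fin 3) :
    ContDiffOn ℝ 1 (hardyField u j) Omega := by
  refine (ContDiffOn.sum fun a _ => (hu a).pow 2).mul ((contDiff_coord j).contDiffOn.mul
    (ContDiffOn.inv (contDiff_norm_sq ℝ).contDiffOn fun x hx => ?_))
  have : 0 < ‖x‖ := lt_trans one_pos hx
  positivity

theorem divergence_hardyField {ι : Type*} [Fintype ι] {u : ι → E3 → ℝ}
    (hu : ∀ a, ContDiffOn ℝ 1 (u a) Omega) {x : E3} (hx : x ∈ Omega) :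
    divergence (hardyField u) x = (∑ a, u a x ^ 2) / ‖x‖ ^ 2 +
      (∑ a, 2 * u a x * ∑ j, x j * partialD j (u a) x) / ‖x‖ ^ 2 := by
  have hx0 : 0 < ‖x‖ := lt_trans one_pos hx
  have key : ∀ j, partialD j (hardyField u j) x =
      (∑ a, 2 * u a x * partialD j (u a) x) * (x j * (‖x‖ ^ 2)⁻¹) +
      (∑ a, u a x ^ 2) * ((‖x‖ ^ 2)⁻¹ + x j * (-(2 * x j) / (‖x‖ ^ 2) ^ 2)) := by
    intro j
    refine partialD_eq_of_hasDerivAt (((contDiffOn_hardyField hu j).contDiffAt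
      (isOpen_Omega.mem_nhds hx)).differentiableAt (by norm_num)) ?_
    have hU := fun a => hasDerivAt_along_zero (k := j) (((hu a).contDiffAt
      (isOpen_Omega.mem_nhds hx)).differentiableAt (by norm_num))
    have h1 := HasDerivAt.fun_sum (u := Finset.univ) fun a _ => (hU a).fun_pow 2
    have h2 := (hasDerivAt_coord_along x j j 0).fun_mul
      ((hasDerivAt_normSq_along x j 0).fun_inv (by simpa using hx0.ne'))
    refine (h1.fun_mul h2).congr_deriv ?_
    simp
  rw [divergence, Finset.sum_congr rfl fun j _ => key j]
  have hsq := sum_coord_sq x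
  rw [Fin.sum_univ_three] at hsq
  have e : ∑ a, 2 * u a x * ∑ j, x j * partialD j (u a) x =
      ∑ j, (∑ a, 2 * u a x * partialD j (u a) x) * x j := by
    simp only [Finset.mul_sum, Finset.sum_mul]
    rw [Finset.sum_comm]
    refine Finset.sum_congr rfl fun j _ => Finset.sum_congr rfl fun a _ => by ring
  rw [e]
  simp only [Fin.sum_univ_three]
  field_simp
  rw [← hsq]
  ring

theorem hardy_pointwise {ι : Type*} [Fintype ι] (u : ι → E3 → ℝ) (x : E3) :
    |∑ a, 2 * u a x * ∑ j, x j * partialD j (u a) x| ≤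
      (∑ a, u a x ^ 2) / 2 + 2 * ‖x‖ ^ 2 * dirichletDensity u x := by
  refine (Finset.abs_sum_le_sum_abs _ _).trans ?_
  rw [dirichletDensity, Finset.mul_sum, Finset.sum_div, ← Finset.sum_add_distrib]
  refine Finset.sum_le_sum fun a _ => ?_
  have hcs : (∑ j, x j * partialD j (u a) x) ^ 2 ≤ ‖x‖ ^ 2 * ∑ j, partialD j (u a) x ^ 2 := by
    rw [← sum_coord_sq]
    exact Finset.sum_mul_sq_le_sq_mul_sq _ _ _
  rw [abs_le]
  constructor
  · nlinarith [sq_nonneg (u a x + 2 * ∑ j, x j * partialD j (u a) x)]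
  · nlinarith [sq_nonneg (u a x - 2 * ∑ j, x j * partialD j (u a) x)]

/-- Hardy-type inequality away from the unit sphere. -/
theorem exists_hardy_bound : ∃ K : ℝ, 0 ≤ K ∧
    ∀ {ι : Type} [Fintype ι] (u : ι → E3 → ℝ) (C : ℝ),
      (∀ a, ContDiffOn ℝ 1 (u a) Omega) → IntegrableOn (dirichletDensity u) Omega →
      IntegrableOn (fun x => (∑ a, u a x ^ 2) / ‖x‖ ^ 2) Omega →
      (∀ x, 2 ≤ ‖x‖ ^ 2 → ‖x‖ ^ 2 ≤ 3 → ∑ a, u a x ^ 2 ≤ C) →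
      ∫ x in Omega, innerCutoff x * ((∑ a, u a x ^ 2) / ‖x‖ ^ 2) ≤
        4 * (∫ x in Omega, innerCutoff x * dirichletDensity u x) + K * C := by
  obtain ⟨K, hK0, hK⟩ := exists_abs_integral_cutoff_divergence_le
  refine ⟨2 * K, by positivity, ?_⟩
  intro ι _ u C hu hSi hUi hbd
  have hcd := contDiffOn_hardyField hu
  have hU0 : ∀ x, 0 ≤ ∑ a, u a x ^ 2 := fun x => Finset.sum_nonneg fun _ _ => sq_nonneg _
  have hbound : ∀ x ∈ Omega, |divergence (hardyField u) x - (∑ a, u a x ^ 2) / ‖x‖ ^ 2| ≤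
      (∑ a, u a x ^ 2) / ‖x‖ ^ 2 / 2 + 2 * dirichletDensity u x := by
    intro x hx
    have hx0 : 0 < ‖x‖ := lt_trans one_pos hx
    rw [divergence_hardyField hu hx, add_sub_cancel_left, abs_div,
      abs_of_pos (by positivity : 0 < ‖x‖ ^ 2), div_le_iff₀ (by positivity)]
    refine (hardy_pointwise u x).trans (le_of_eq ?_)
    field_simp
  have hdomi : IntegrableOn (fun x => (∑ a, u a x ^ 2) / ‖x‖ ^ 2 / 2 +
      2 * dirichletDensity u x) Omega := (hUi.div_const 2).add (hSi.const_mul 2)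
  have hdivm : AEStronglyMeasurable (divergence (hardyField u)) (volume.restrict Omega) := by
    refine ContinuousOn.aestronglyMeasurable ?_ isOpen_Omega.measurableSet
    refine continuousOn_finsetSum _ fun j _ => ?_
    exact ((hcd j).continuousOn_fderiv_of_isOpen isOpen_Omega (by norm_num)).clm_apply
      continuousOn_const
  have hdivi : IntegrableOn (divergence (hardyField u)) Omega := by
    have : IntegrableOn (fun x => divergence (hardyField u) x -
        (∑ a, u a x ^ 2) / ‖x‖ ^ 2) Omega :=
      hdomi.mono' (hdivm.sub hUi.aestronglyMeasurable)
        (ae_restrict_of_forall_mem isOpen_Omega.measurableSet hbound)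
    exact (this.add hUi).congr_fun (fun x _ => by simp) isOpen_Omega.measurableSet
  have h := hK (hardyField u) C hcd ?_ (integrableOn_innerCutoff_mul hdivi) ?_
  · have h1 : ∫ x in Omega, innerCutoff x * ((∑ a, u a x ^ 2) / ‖x‖ ^ 2) ≤
        ∫ x in Omega, (2 * (innerCutoff x * divergence (hardyField u) x) +
          4 * (innerCutoff x * dirichletDensity u x)) := by
      refine setIntegral_mono_on (integrableOn_innerCutoff_mul hUi)
        (((integrableOn_innerCutoff_mul hdivi).const_mul 2).add
          ((integrableOn_innerCutoff_mul hSi).const_mul 4)) isOpen_Omega.measurableSet ?_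
      intro x hx
      have h2 := (abs_le.1 (hbound x hx)).1
      have h3 : (∑ a, u a x ^ 2) / ‖x‖ ^ 2 ≤ 2 * divergence (hardyField u) x +
          4 * dirichletDensity u x := by linarith
      have := mul_le_mul_of_nonneg_left h3 (innerCutoff_nonneg x)
      linarith
    rw [integral_add ((integrableOn_innerCutoff_mul hdivi).const_mul 2)
      ((integrableOn_innerCutoff_mul hSi).const_mul 4), integral_const_mul, integral_const_mul] at h1
    have := (abs_le.1 h).2
    linarith
  · intro j
    refine Integrable.mono' hUi ?_ ?_
    · refine ContinuousOn.aestronglyMeasurable ?_ isOpen_Omega.measurableSet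
      refine (hcd j).continuousOn.div continuous_norm.continuousOn fun x hx => ?_
      exact (lt_trans one_pos hx).ne'
    · refine ae_restrict_of_forall_mem isOpen_Omega.measurableSet fun x hx => ?_
      have hx0 : 0 < ‖x‖ := lt_trans one_pos hx
      rw [hardyField, norm_div, norm_norm, norm_mul, norm_mul, Real.norm_of_nonneg (hU0 x),
        Real.norm_of_nonneg (by positivity : 0 ≤ (‖x‖ ^ 2)⁻¹), mul_div_assoc]
      refine mul_le_mul_of_nonneg_left ?_ (hU0 x)
      rw [div_le_iff₀ hx0, mul_comm]
      exact mul_le_mul_of_nonneg_left (abs_coord_le_norm x j) (by positivity)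
  · intro j x h2 h3
    have hx1 : 1 ≤ ‖x‖ := by nlinarith [norm_nonneg x]
    rw [hardyField, abs_mul, abs_mul, abs_of_nonneg (hU0 x),
      abs_of_nonneg (by positivity : 0 ≤ (‖x‖ ^ 2)⁻¹)]
    refine (mul_le_of_le_one_right (hU0 x) ?_).trans (hbd x h2 h3)
    rw [← div_eq_mul_inv, div_le_one (by positivity)]
    exact (abs_coord_le_norm x j).trans (by nlinarith)

theorem mnormSq_eq_sum {Q : Mat3} (hQ : Q.IsSymm) : mnormSq Q = ∑ i, ∑ j, Q i j ^ 2 := by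
  simp only [mnormSq, Matrix.trace, Matrix.diag, Matrix.mul_apply]
  exact Finset.sum_congr rfl fun i _ => Finset.sum_congr rfl fun j _ => by rw [hQ.apply i j]; ring

theorem mnormSq_nonneg {Q : Mat3} (hQ : Q.IsSymm) : 0 ≤ mnormSq Q := by
  rw [mnormSq_eq_sum hQ]
  exact Finset.sum_nonneg fun _ _ => Finset.sum_nonneg fun _ _ => sq_nonneg _

theorem entry_sq_le_mnormSq {Q : Mat3} (hQ : Q.IsSymm) (i j : Fin 3) : Q i j ^ 2 ≤ mnormSq Q := by
  rw [mnormSq_eq_sum hQ]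
  refine (Finset.single_le_sum (f := fun j => Q i j ^ 2) (fun _ _ => sq_nonneg _)
    (Finset.mem_univ j)).trans ?_
  exact Finset.single_le_sum (f := fun i => ∑ j, Q i j ^ 2)
    (fun _ _ => Finset.sum_nonneg fun _ _ => sq_nonneg _) (Finset.mem_univ i)

theorem sum_mul_self_sq_le {Q : Mat3} (hQ : Q.IsSymm) :
    ∑ i, ∑ j, (Q * Q) i j ^ 2 ≤ mnormSq Q ^ 2 := by
  have h : ∀ i j, (Q * Q) i j ^ 2 ≤ (∑ k, Q i k ^ 2) * ∑ k, Q k j ^ 2 := fun i j => by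
    rw [Matrix.mul_apply]
    exact Finset.sum_mul_sq_le_sq_mul_sq _ _ _
  calc _ ≤ ∑ i, ∑ j, (∑ k, Q i k ^ 2) * ∑ k, Q k j ^ 2 :=
        Finset.sum_le_sum fun i _ => Finset.sum_le_sum fun j _ => h i j
    _ = (∑ i, ∑ k, Q i k ^ 2) * ∑ j, ∑ k, Q k j ^ 2 := (Finset.sum_mul_sum _ _ _ _).symm
    _ = _ := by
      rw [Finset.sum_comm (f := fun j k => Q k j ^ 2), ← mnormSq_eq_sum hQ, sq]

theorem trace_cube_eq {Q : Mat3} (hQ : Q.IsSymm) :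
    (Q * Q * Q).trace = ∑ i, ∑ j, (Q * Q) i j * Q i j := by
  rw [Matrix.trace]
  refine Finset.sum_congr rfl fun i _ => ?_
  rw [Matrix.diag_apply, Matrix.mul_apply]
  exact Finset.sum_congr rfl fun j _ => by rw [hQ.apply i j]

theorem abs_mul_trace_cube_le (b : ℝ) {c : ℝ} (hc : 0 < c) {Q : Mat3} (hQ : Q.IsSymm) :
    |b * (Q * Q * Q).trace| ≤ b ^ 2 / (2 * c) * mnormSq Q + c / 2 * mnormSq Q ^ 2 := by
  have h1 : |b * (Q * Q * Q).trace| ≤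
      ∑ i, ∑ j, (b ^ 2 / (2 * c) * Q i j ^ 2 + c / 2 * (Q * Q) i j ^ 2) := by
    rw [trace_cube_eq hQ, Finset.mul_sum]
    refine (Finset.abs_sum_le_sum_abs _ _).trans (Finset.sum_le_sum fun i _ => ?_)
    rw [Finset.mul_sum]
    refine (Finset.abs_sum_le_sum_abs _ _).trans (Finset.sum_le_sum fun j _ => ?_)
    set p := (Q * Q) i j
    set q := Q i j
    have e : b ^ 2 / (2 * c) * q ^ 2 + c / 2 * p ^ 2 = ((b * q) ^ 2 + (c * p) ^ 2) / (2 * c) := by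
      field_simp
    rw [e, le_div_iff₀ (by positivity)]
    rcases abs_cases (b * (p * q)) with ⟨h, _⟩ | ⟨h, _⟩ <;> rw [h]
    · nlinarith [sq_nonneg (b * q - c * p)]
    · nlinarith [sq_nonneg (b * q + c * p)]
  refine h1.trans ?_
  simp only [Finset.sum_add_distrib, ← Finset.mul_sum]
  rw [← mnormSq_eq_sum hQ]
  have := mul_le_mul_of_nonneg_left (sum_mul_self_sq_le hQ) (by positivity : 0 ≤ c / 2)
  linarith

theorem gradf_apply (a b c : ℝ) (Q : Mat3) (i j : Fin 3) : gradf a b c Q i j =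
    -a * Q i j - b * ((Q * Q) i j - mnormSq Q / 3 * (1 : Mat3) i j) + c * mnormSq Q * Q i j := by
  simp [gradf]

theorem sum_mul_gradf_eq {a b c : ℝ} {Q : Mat3} (hQ : isS0 Q) :
    ∑ i, ∑ j, Q i j * gradf a b c Q i j =
      -a * mnormSq Q - b * (Q * Q * Q).trace + c * mnormSq Q ^ 2 := by
  have htr : Q 0 0 + Q 1 1 + Q 2 2 = 0 := by
    have := hQ.2
    rwa [Matrix.trace, Fin.sum_univ_three] at this
  have h1 : ∀ i j, Q i j * gradf a b c Q i j = (-a + c * mnormSq Q) * Q i j ^ 2 -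
      b * ((Q * Q) i j * Q i j) + b * (mnormSq Q / 3) * ((1 : Mat3) i j * Q i j) := fun i j => by
    rw [gradf_apply]; ring
  have h2 : ∑ i, ∑ j, (1 : Mat3) i j * Q i j = 0 := by
    simp [Fin.sum_univ_three, Matrix.one_apply]; linarith
  simp only [h1, Finset.sum_add_distrib, Finset.sum_sub_distrib, ← Finset.mul_sum, h2]
  rw [← mnormSq_eq_sum hQ.1, ← trace_cube_eq hQ.1]
  ring

theorem le_sum_mul_gradf {a b c : ℝ} (hc : 0 < c) {Q : Mat3} (hQ : isS0 Q) :
    c / 4 * (mnormSq Q ^ 2 - (2 * (a + b ^ 2 / (2 * c)) / c) ^ 2) ≤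
      ∑ i, ∑ j, Q i j * gradf a b c Q i j := by
  rw [sum_mul_gradf_eq hQ]
  have h1 := (abs_le.1 (abs_mul_trace_cube_le b hc hQ.1)).2
  set A := a + b ^ 2 / (2 * c) with hA
  have h2 : c / 4 * (mnormSq Q ^ 2 - (2 * A / c) ^ 2) = c / 2 * mnormSq Q ^ 2 - A * mnormSq Q -
      c / 4 * (mnormSq Q - 2 * A / c) ^ 2 := by
    field_simp; ring
  have h3 : 0 ≤ c / 4 * (mnormSq Q - 2 * A / c) ^ 2 := by positivity
  rw [h2]
  nlinarith

theorem abs_entry_le {Q : Mat3} (hQ : Q.IsSymm) {M : ℝ} (hM : mnormSq Q ≤ M) (i j : Fin 3) :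
    |Q i j| ≤ 1 + M := by
  have := entry_sq_le_mnormSq hQ i j
  rw [← sq_abs] at this
  nlinarith [sq_nonneg (|Q i j| - 1), sq_nonneg (|Q i j|)]

theorem abs_gradf_le {a b c : ℝ} (ha : 0 ≤ a) (hb : 0 < b) (hc : 0 < c) {Q : Mat3}
    (hQ : Q.IsSymm) {M : ℝ} (hM : mnormSq Q ≤ M) (i j : Fin 3) :
    |gradf a b c Q i j| ≤ a * (1 + M) + b * (M + M) + c * M * (1 + M) := by
  have h0 := mnormSq_nonneg hQ
  have hM0 := h0.trans hM
  have h1 := abs_entry_le hQ hM i j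
  have h2 : |(Q * Q) i j| ≤ M := by
    refine (abs_le_of_sq_le_sq ?_ h0).trans hM
    refine le_trans ?_ (sum_mul_self_sq_le hQ)
    refine (Finset.single_le_sum (f := fun j => (Q * Q) i j ^ 2) (fun _ _ => sq_nonneg _)
      (Finset.mem_univ j)).trans ?_
    exact Finset.single_le_sum (f := fun i => ∑ j, (Q * Q) i j ^ 2)
      (fun _ _ => Finset.sum_nonneg fun _ _ => sq_nonneg _) (Finset.mem_univ i)
  have h3 : |mnormSq Q / 3 * (1 : Mat3) i j| ≤ M := by
    rw [Matrix.one_apply]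
    split_ifs
    · rw [mul_one, abs_of_nonneg (by positivity)]; linarith
    · simp; linarith
  rw [gradf_apply]
  refine (abs_add_le _ _).trans (add_le_add ((abs_sub _ _).trans (add_le_add ?_ ?_)) ?_)
  · rw [abs_mul, abs_neg, abs_of_nonneg ha]; gcongr
  · rw [abs_mul, abs_of_pos hb]; gcongr
    exact (abs_sub _ _).trans (add_le_add h2 h3)
  · rw [abs_mul, abs_mul, abs_of_pos hc, abs_of_nonneg h0]; gcongr

theorem fpot_nonneg {a b c : ℝ} (hc : 0 < c) {Q : Mat3} (hQ : isS0 Q) :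
    0 ≤ fpot a b c Q := by
  have hbdd : BddBelow (gpot a b c '' {Q | isS0 Q}) := by
    refine ⟨-(3 * (a / 2 + b ^ 2 / (6 * c)) ^ 2 / c), ?_⟩
    rintro _ ⟨P, hP, rfl⟩
    have h1 := (abs_le.1 (abs_mul_trace_cube_le b hc (show isS0 P from hP).1)).2
    unfold gpot
    rw [show (P * P).trace = mnormSq P from rfl]
    set t := mnormSq P
    set B := a / 2 + b ^ 2 / (6 * c) with hB
    have h2 : -(3 * B ^ 2 / c) = c / 12 * t ^ 2 - B * t - c / 12 * (t - 6 * B / c) ^ 2 := by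
      field_simp; ring
    have h3 : 0 ≤ c / 12 * (t - 6 * B / c) ^ 2 := by positivity
    have h4 : B * t = a / 2 * t + (b ^ 2 / (2 * c) * t) / 3 := by rw [hB]; field_simp; ring
    rw [h2, h4]
    linarith
  have := csInf_le hbdd ⟨Q, hQ, rfl⟩
  unfold fpot Cconst
  linarith

theorem fpot_le {a b c : ℝ} (ha : 0 ≤ a) (hc : 0 < c) {Q : Mat3} (hQ : isS0 Q)
    {M : ℝ} (hM : mnormSq Q ≤ M) :
    fpot a b c Q ≤ b ^ 2 / (2 * c) * M + c * M ^ 2 + |Cconst a b c| := by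
  have h0 := mnormSq_nonneg hQ.1
  have h1 := (abs_le.1 (abs_mul_trace_cube_le b hc hQ.1)).1
  have h2 := le_abs_self (Cconst a b c)
  unfold fpot gpot
  rw [show (Q * Q).trace = mnormSq Q from rfl]
  set t := mnormSq Q
  have h3 : t ^ 2 ≤ M ^ 2 := by gcongr
  have h4 : b ^ 2 / (2 * c) * t ≤ b ^ 2 / (2 * c) * M := by gcongr
  have h5 : 0 ≤ b ^ 2 / (2 * c) * t := by positivity
  have h6 : c * t ^ 2 ≤ c * M ^ 2 := by gcongr
  have h7 : 0 ≤ c * t ^ 2 := by positivity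
  have h8 : 0 ≤ a * t := by positivity
  linarith

/-- The scalar entries of a matrix field. -/
def entry (Q : E3 → Mat3) (a : Fin 3 × Fin 3) (x : E3) : ℝ := Q x a.1 a.2

theorem OmegaBar_mem_nhds {x : E3} (hx : x ∈ Omega) : OmegaBar ∈ 𝓝 x :=
  mem_of_superset (isOpen_Omega.mem_nhds hx) Omega_subset_OmegaBar

theorem pd_eq_partialD {g : E3 → ℝ} (k : Fin 3) {x : E3} (hx : x ∈ Omega) :
    pd g k x = partialD k g x := by
  rw [pd, partialD, fderivWithin_of_mem_nhds (OmegaBar_mem_nhds hx)]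

theorem partialD_congr {f g : E3 → ℝ} (h : EqOn f g Omega) (k : Fin 3) {x : E3} (hx : x ∈ Omega) :
    partialD k f x = partialD k g x := by
  rw [partialD, partialD, (h.eventuallyEq_of_mem (isOpen_Omega.mem_nhds hx)).fderiv_eq]

theorem lap3_eq_sum_partialD {g : E3 → ℝ} {x : E3} (hx : x ∈ Omega) :
    lap3 g x = ∑ k, partialD k (partialD k g) x := by
  refine Finset.sum_congr rfl fun k _ => ?_
  rw [pd_eq_partialD k hx]
  exact partialD_congr (fun y hy => pd_eq_partialD k hy) k hx

theorem gradSq_eq_dirichletDensity (Q : E3 → Mat3) {x : E3} (hx : x ∈ Omega) :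
    gradSq Q x = dirichletDensity (entry Q) x := by
  simp only [gradSq, dirichletDensity, Fintype.sum_prod_type, pd_eq_partialD _ hx]
  rfl

theorem RegC.contDiffOn_entry {Q : E3 → Mat3} (h : RegC 2 Q) (a : Fin 3 × Fin 3) :
    ContDiffOn ℝ 2 (entry Q a) Omega :=
  (h a.1 a.2).mono Omega_subset_OmegaBar

theorem RegC.continuousOn_entry {Q : E3 → Mat3} (h : RegC 2 Q) (a : Fin 3 × Fin 3) :
    ContinuousOn (entry Q a) OmegaBar := (h a.1 a.2).continuousOn

theorem mnormSq_eq_sum_entry {Q : E3 → Mat3} {x : E3} (h : (Q x).IsSymm) :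
    mnormSq (Q x) = ∑ a, entry Q a x ^ 2 := by
  rw [mnormSq_eq_sum h, Fintype.sum_prod_type]; rfl

theorem hasDerivWithinAt_radial_entry {a b c L W : ℝ} (hL : 0 < L) (hW : 0 < W) {Q : E3 → Mat3}
    (hreg : RegC 2 Q) (hbc : weakAnchor a b c L W Q) (p : Fin 3 × Fin 3) {x : E3}
    (hx : ‖x‖ = 1) :
    HasDerivWithinAt (fun t : ℝ => entry Q p (x + t • x))
      (W / L * (entry Q p x - Qsurf a b c x p.1 p.2)) (Ici 0) 0 := by
  have hxO : x ∈ OmegaBar := hx.ge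
  have hd : DifferentiableWithinAt ℝ (entry Q p) OmegaBar x :=
    (hreg p.1 p.2).differentiableOn (by norm_num) x hxO
  have h1 : HasDerivWithinAt (fun t : ℝ => x + t • x) x (Ici 0) 0 := by
    simpa using (((hasDerivAt_id (0 : ℝ)).smul_const x).const_add x).hasDerivWithinAt
  have hmaps : MapsTo (fun t : ℝ => x + t • x) (Ici 0) OmegaBar := by
    intro t ht
    have ht' : (0 : ℝ) ≤ t := ht
    show 1 ≤ ‖x + t • x‖
    rw [show x + t • x = (1 + t) • x by rw [add_smul, one_smul], norm_smul, hx,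
      Real.norm_of_nonneg (by linarith)]
    linarith
  have h2 : HasFDerivWithinAt (entry Q p) (fderivWithin ℝ (entry Q p) OmegaBar x) OmegaBar
      (x + (0 : ℝ) • x) := by simpa using hd.hasFDerivWithinAt
  refine (h2.comp_hasDerivWithinAt 0 h1 hmaps).congr_deriv ?_
  have h3 : L / W * -(fderivWithin ℝ (entry Q p) OmegaBar x x) =
      Qsurf a b c x p.1 p.2 - entry Q p x := by
    have := congrFun (congrFun (hbc x hx) p.1) p.2
    simp only [nuDeriv, er, hx, inv_one, one_smul, Matrix.smul_apply, Matrix.of_apply, map_neg,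
      smul_eq_mul, Matrix.sub_apply] at this
    exact this
  rw [← neg_sub, ← h3]
  field_simp

theorem isEL.laplacian_entry {a b c L : ℝ} (hL : 0 < L) {Q : E3 → Mat3} (h : isEL a b c L Q)
    {x : E3} (hx : x ∈ Omega) (p : Fin 3 × Fin 3) :
    ∑ k, partialD k (partialD k (entry Q p)) x = gradf a b c (Q x) p.1 p.2 / L := by
  rw [← h x hx, Matrix.smul_apply, smul_eq_mul, mul_div_cancel_left₀ _ hL.ne', matLap,
    Matrix.of_apply, lap3_eq_sum_partialD hx]
  rfl

theorem laplacian_sum_sq {ι : Type*} [Fintype ι] {q : ι → E3 → ℝ}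
    (hq : ∀ a, ContDiffOn ℝ 2 (q a) Omega) {x : E3} (hx : x ∈ Omega) :
    ∑ k, partialD k (partialD k fun y => ∑ a, q a y ^ 2) x =
      2 * dirichletDensity q x + 2 * ∑ a, q a x * ∑ k, partialD k (partialD k (q a)) x := by
  have hD := fun a (y : E3) (hy : y ∈ Omega) =>
    ((hq a).contDiffAt (isOpen_Omega.mem_nhds hy)).differentiableAt (by norm_num)
  have h1 : ∀ k, EqOn (partialD k fun y => ∑ a, q a y ^ 2)
      (fun y => ∑ a, 2 * q a y * partialD k (q a) y) Omega := by
    intro k y hy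
    refine partialD_eq_of_hasDerivAt ?_ ?_
    · exact DifferentiableAt.fun_sum fun a _ => (hD a y hy).pow 2
    · refine (HasDerivAt.fun_sum (u := Finset.univ) fun a _ =>
        (hasDerivAt_along_zero (k := k) (hD a y hy)).fun_pow 2).congr_deriv ?_
      simp
  have h2 : ∀ k, partialD k (partialD k fun y => ∑ a, q a y ^ 2) x =
      ∑ a, (2 * partialD k (q a) x * partialD k (q a) x +
        2 * q a x * partialD k (partialD k (q a)) x) := by
    intro k
    rw [partialD_congr (h1 k) k hx]
    refine partialD_eq_of_hasDerivAt ?_ ?_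
    · refine DifferentiableAt.fun_sum fun a _ => ((hD a x hx).const_mul 2).mul ?_
      exact ((contDiffOn_partialD isOpen_Omega (hq a) k).contDiffAt
        (isOpen_Omega.mem_nhds hx)).differentiableAt (by norm_num)
    · refine (HasDerivAt.fun_sum (u := Finset.univ) fun a _ =>
        ((hasDerivAt_along_zero (k := k) (hD a x hx)).const_mul 2).fun_mul
          (hasDerivAt_partialD_along isOpen_Omega (hq a) hx k k)).congr_deriv ?_
      simp
  rw [Finset.sum_congr rfl fun k _ => h2 k, Finset.sum_comm, dirichletDensity, Finset.mul_sum,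
    Finset.mul_sum, ← Finset.sum_add_distrib]
  refine Finset.sum_congr rfl fun a _ => ?_
  simp only [Fin.sum_univ_three]
  ring

theorem sum_Qsurf_sq_le (a b c : ℝ) {x : E3} (hx : ‖x‖ = 1) :
    ∑ p : Fin 3 × Fin 3, Qsurf a b c x p.1 p.2 ^ 2 ≤ 36 * sstar a b c ^ 2 := by
  have h : ∀ p : Fin 3 × Fin 3, Qsurf a b c x p.1 p.2 ^ 2 ≤ 4 * sstar a b c ^ 2 := by
    intro p
    have h1 := abs_coord_le_norm x p.1
    have h2 := abs_coord_le_norm x p.2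
    rw [hx] at h1 h2
    have h3 : |x p.1 * x p.2| ≤ 1 := by
      rw [abs_mul]; exact mul_le_one₀ h1 (abs_nonneg _) h2
    have h4 : |(1 / 3 : ℝ) * (1 : Mat3) p.1 p.2| ≤ 1 := by
      rw [Matrix.one_apply]; split_ifs <;> norm_num
    have h5 : Qsurf a b c x p.1 p.2 =
        sstar a b c * (x p.1 * x p.2 - 1 / 3 * (1 : Mat3) p.1 p.2) := by
      simp [Qsurf, outer, er, hx]
    have h6 : (x p.1 * x p.2 - 1 / 3 * (1 : Mat3) p.1 p.2) ^ 2 ≤ 4 := by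
      have : |x p.1 * x p.2 - 1 / 3 * (1 : Mat3) p.1 p.2| ≤ 2 :=
        (abs_sub _ _).trans (by linarith)
      rw [← sq_abs]
      nlinarith [abs_nonneg (x p.1 * x p.2 - 1 / 3 * (1 : Mat3) p.1 p.2)]
    rw [h5, mul_pow, mul_comm]
    exact mul_le_mul_of_nonneg_right h6 (sq_nonneg _)
  calc _ ≤ ∑ _p : Fin 3 × Fin 3, 4 * sstar a b c ^ 2 := Finset.sum_le_sum fun p _ => h p
    _ = _ := by simp; ring

/-- A priori bound on `|Q|²`, independent of the elastic and anchoring constants. -/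
def aPrioriBound (a b c : ℝ) : ℝ :=
  max (|2 * (a + b ^ 2 / (2 * c)) / c|) (36 * sstar a b c ^ 2)

theorem aPrioriBound_nonneg (a b c : ℝ) : 0 ≤ aPrioriBound a b c :=
  (abs_nonneg _).trans (le_max_left _ _)

theorem sum_entry_sq_le {a b c L W : ℝ} (hc : 0 < c) (hL : 0 < L) (hW : 0 < W) {Q : E3 → Mat3}
    (hreg : RegC 2 Q) (hS : ∀ x ∈ OmegaBar, isS0 (Q x)) (hEL : isEL a b c L Q)
    (hbc : weakAnchor a b c L W Q) {x : E3} (hx : x ∈ OmegaBar) :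
    ∑ p, entry Q p x ^ 2 ≤ aPrioriBound a b c := by
  have hq := hreg.contDiffOn_entry
  have hWL : 0 < W / L := by positivity
  refine keller_osserman_bound (g := fun x => ∑ p, entry Q p x ^ 2) (w := W / L)
    (κ := c / (2 * L)) hWL (by positivity)
    (aPrioriBound_nonneg a b c) ?_ ?_ ?_ ?_ hx
  · exact continuousOn_finsetSum _ fun p _ => (hreg.continuousOn_entry p).pow 2
  · exact ContDiffOn.sum fun p _ => (hq p).pow 2
  · intro y hy
    have hSy := hS y (Omega_subset_OmegaBar hy)
    rw [laplacian_sum_sq hq hy, ← mnormSq_eq_sum_entry hSy.1]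
    have h1 := le_sum_mul_gradf (a := a) (b := b) hc hSy
    have h2 : ∑ p, entry Q p y * ∑ k, partialD k (partialD k (entry Q p)) y =
        (∑ i, ∑ j, Q y i j * gradf a b c (Q y) i j) / L := by
      simp only [hEL.laplacian_entry hL hy, Fintype.sum_prod_type, Finset.sum_div, mul_div_assoc]
      rfl
    have h3 : (2 * (a + b ^ 2 / (2 * c)) / c) ^ 2 ≤ aPrioriBound a b c ^ 2 := by
      rw [← sq_abs]
      exact pow_le_pow_left₀ (abs_nonneg _) (le_max_left _ _) 2
    have h4 : c / (2 * L) * (mnormSq (Q y) ^ 2 - aPrioriBound a b c ^ 2) =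
        2 * (c / 4 * (mnormSq (Q y) ^ 2 - aPrioriBound a b c ^ 2) / L) := by
      field_simp; ring
    have h5 : c / 4 * (mnormSq (Q y) ^ 2 - aPrioriBound a b c ^ 2) / L ≤
        (∑ i, ∑ j, Q y i j * gradf a b c (Q y) i j) / L := by
      refine div_le_div_of_nonneg_right (le_trans ?_ h1) hL.le
      exact mul_le_mul_of_nonneg_left (by linarith) (by positivity)
    rw [h2, h4]
    have := dirichletDensity_nonneg (entry Q) y
    linarith
  · intro y hy
    refine ⟨∑ p, 2 * entry Q p y * (W / L * (entry Q p y - Qsurf a b c y p.1 p.2)), ?_, ?_⟩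
    · have h1 : ∑ p : Fin 3 × Fin 3, Qsurf a b c y p.1 p.2 ^ 2 ≤ aPrioriBound a b c :=
        (sum_Qsurf_sq_le a b c hy).trans (le_max_right _ _)
      have h2 : ∑ p, W / L * (entry Q p y ^ 2 - Qsurf a b c y p.1 p.2 ^ 2) ≤
          ∑ p, 2 * entry Q p y * (W / L * (entry Q p y - Qsurf a b c y p.1 p.2)) := by
        refine Finset.sum_le_sum fun p _ => ?_
        have := mul_nonneg hWL.le (sq_nonneg (entry Q p y - Qsurf a b c y p.1 p.2))
        nlinarith
      rw [← Finset.mul_sum, Finset.sum_sub_distrib] at h2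
      refine le_trans ?_ h2
      exact mul_le_mul_of_nonneg_left (by linarith) hWL.le
    · refine (HasDerivWithinAt.fun_sum (u := Finset.univ) fun p _ =>
        (hasDerivWithinAt_radial_entry hL hW hreg hbc p hy).fun_pow 2).congr_deriv ?_
      simp

theorem fpot_eq_sum (a b c : ℝ) (Q : Mat3) : fpot a b c Q =
    -(a / 2) * ∑ i, ∑ j, Q i j * Q j i - b / 3 * ∑ i, ∑ k, (∑ j, Q i j * Q j k) * Q k i +
      c / 4 * (∑ i, ∑ j, Q i j * Q j i) ^ 2 + Cconst a b c := by
  simp only [fpot, gpot, Matrix.trace, Matrix.diag, Matrix.mul_apply]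

theorem contDiffOn_fpot {a b c : ℝ} {Q : E3 → Mat3} (hq : ∀ p, ContDiffOn ℝ 2 (entry Q p) Omega) :
    ContDiffOn ℝ 1 (fun y => fpot a b c (Q y)) Omega := by
  have h : ∀ i j, ContDiffOn ℝ 1 (fun y => Q y i j) Omega := fun i j =>
    (hq (i, j)).of_le (by norm_num)
  have h2 : ContDiffOn ℝ 1 (fun y => ∑ i, ∑ j, Q y i j * Q y j i) Omega :=
    ContDiffOn.sum fun i _ => ContDiffOn.sum fun j _ => (h i j).mul (h j i)
  have h3 : ContDiffOn ℝ 1 (fun y => ∑ i, ∑ k, (∑ j, Q y i j * Q y j k) * Q y k i) Omega :=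
    ContDiffOn.sum fun i _ => ContDiffOn.sum fun k _ =>
      (ContDiffOn.sum fun j _ => (h i j).mul (h j k)).mul (h k i)
  simp only [fpot_eq_sum]
  exact (((contDiffOn_const.mul h2).sub (contDiffOn_const.mul h3)).add
    (contDiffOn_const.mul (h2.pow 2))).add contDiffOn_const

theorem partialD_fpot {a b c : ℝ} {Q : E3 → Mat3} (hq : ∀ p, ContDiffOn ℝ 2 (entry Q p) Omega)
    (hS : ∀ x ∈ OmegaBar, isS0 (Q x)) {x : E3} (hx : x ∈ Omega) (l : Fin 3) :
    partialD l (fun y => fpot a b c (Q y)) x =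
      ∑ p, gradf a b c (Q x) p.1 p.2 * partialD l (entry Q p) x := by
  set D : Fin 3 → Fin 3 → ℝ := fun i j => partialD l (entry Q (i, j)) x with hD
  have hd : ∀ i j, HasDerivAt
      (fun t : ℝ => Q (x + t • (EuclideanSpace.single l 1 : E3)) i j) (D i j) 0 := fun i j =>
    hasDerivAt_along_zero (f := entry Q (i, j)) (((hq (i, j)).contDiffAt
      (isOpen_Omega.mem_nhds hx)).differentiableAt (by norm_num))
  have hDs : ∀ i j, D i j = D j i := fun i j => partialD_congr (fun y hy =>
    (hS y (Omega_subset_OmegaBar hy)).1.apply j i) l hx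
  have hDt : D 0 0 + D 1 1 + D 2 2 = 0 := by
    have h1 := ((hd 0 0).fun_add (hd 1 1)).fun_add (hd 2 2)
    have h2 : (fun t : ℝ => Q (x + t • (EuclideanSpace.single l 1 : E3)) 0 0 +
        Q (x + t • (EuclideanSpace.single l 1 : E3)) 1 1 +
        Q (x + t • (EuclideanSpace.single l 1 : E3)) 2 2) =ᶠ[𝓝 0] fun _ => 0 := by
      filter_upwards [eventually_line_mem isOpen_Omega hx l] with t ht
      have := (hS _ (Omega_subset_OmegaBar ht)).2
      rwa [Matrix.trace, Fin.sum_univ_three] at this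
    exact h1.unique ((hasDerivAt_const (0 : ℝ) (0 : ℝ)).congr_of_eventuallyEq h2)
  have hs := (hS x (Omega_subset_OmegaBar hx)).1
  have h2 := HasDerivAt.fun_sum (u := Finset.univ) fun i _ =>
    HasDerivAt.fun_sum (u := Finset.univ) fun j _ => (hd i j).fun_mul (hd j i)
  have h3 := HasDerivAt.fun_sum (u := Finset.univ) fun i _ =>
    HasDerivAt.fun_sum (u := Finset.univ) fun k _ =>
      (HasDerivAt.fun_sum (u := Finset.univ) fun j _ => (hd i j).fun_mul (hd j k)).fun_mul (hd k i)
  have h4 := (((h2.const_mul (-(a / 2))).fun_sub (h3.const_mul (b / 3))).fun_add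
    ((h2.fun_pow 2).const_mul (c / 4))).add_const (Cconst a b c)
  have h5 : partialD l (fun y => fpot a b c (Q y)) x = _ :=
    partialD_eq_of_hasDerivAt (((contDiffOn_fpot hq).contDiffAt
      (isOpen_Omega.mem_nhds hx)).differentiableAt (by norm_num)) (by
        simp only [fpot_eq_sum]; exact h4)
  rw [h5, Fintype.sum_prod_type]
  have e1 : D 2 2 = -(D 0 0 + D 1 1) := by linarith
  have e2 : mnormSq (Q x) = ∑ i, ∑ j, Q x i j ^ 2 := mnormSq_eq_sum hs
  change _ = ∑ i, ∑ j, gradf a b c (Q x) i j * D i j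
  simp only [gradf_apply, Matrix.mul_apply, e2, zero_smul, add_zero]
  simp only [Fin.sum_univ_three, hs.apply 0 1, hs.apply 0 2, hs.apply 1 2, hDs 1 0, hDs 2 0,
    hDs 2 1, e1, Matrix.one_apply]
  simp
  ring

/-- `Q` is a finite-energy solution of the Euler–Lagrange equation with weak anchoring. -/
structure IsSolution (a b c L W : ℝ) (Q : E3 → Mat3) : Prop where
  elastic_pos : 0 < L
  anchoring_pos : 0 < W
  regular : RegC 2 Q
  mem : memH a b c Q
  eulerLagrange : isEL a b c L Q
  anchoring : weakAnchor a b c L W Q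
  finiteEnergy : IntegrableOn (fun x => L / 2 * gradSq Q x + fpot a b c (Q x)) Omega volume

/-- A uniform bound for the entries of `∇f(Q)` along solutions. -/
def gradfBound (a b c : ℝ) : ℝ :=
  a * (1 + aPrioriBound a b c) + b * (aPrioriBound a b c + aPrioriBound a b c) +
    c * aPrioriBound a b c * (1 + aPrioriBound a b c)

theorem gradfBound_nonneg {a b c : ℝ} (ha : 0 ≤ a) (hb : 0 < b) (hc : 0 < c) :
    0 ≤ gradfBound a b c := by
  have := aPrioriBound_nonneg a b c
  unfold gradfBound
  positivity

namespace IsSolution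

variable {a b c L W : ℝ} {Q : E3 → Mat3}

theorem mnormSq_le (h : IsSolution a b c L W Q) (hc : 0 < c) {x : E3} (hx : x ∈ OmegaBar) :
    mnormSq (Q x) ≤ aPrioriBound a b c := by
  rw [mnormSq_eq_sum_entry (h.mem.1 x hx).1]
  exact sum_entry_sq_le hc h.elastic_pos h.anchoring_pos h.regular h.mem.1 h.eulerLagrange
    h.anchoring hx

theorem abs_entry_le (h : IsSolution a b c L W Q) (hc : 0 < c) (p : Fin 3 × Fin 3) {x : E3}
    (hx : x ∈ OmegaBar) : |entry Q p x| ≤ 1 + aPrioriBound a b c :=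
  _root_.abs_entry_le (h.mem.1 x hx).1 (h.mnormSq_le hc hx) p.1 p.2

theorem abs_laplacian_le (h : IsSolution a b c L W Q) (ha : 0 ≤ a) (hb : 0 < b) (hc : 0 < c)
    (p : Fin 3 × Fin 3) {x : E3} (hx : x ∈ Omega) :
    |∑ k, partialD k (partialD k (entry Q p)) x| ≤ gradfBound a b c / L := by
  have hx' := Omega_subset_OmegaBar hx
  rw [h.eulerLagrange.laplacian_entry h.elastic_pos hx p, abs_div, abs_of_pos h.elastic_pos]
  exact div_le_div_of_nonneg_right
    (abs_gradf_le ha hb hc (h.mem.1 x hx').1 (h.mnormSq_le hc hx') p.1 p.2) h.elastic_pos.le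

theorem abs_partialD_le (h : IsSolution a b c L W Q) (ha : 0 ≤ a) (hb : 0 < b) (hc : 0 < c)
    (p : Fin 3 × Fin 3) (k : Fin 3) {x : E3} {d N : ℝ} (hd : 0 < d) (hx : 1 + 2 * d ≤ ‖x‖)
    (hN : gradfBound a b c / L < N) :
    |partialD k (entry Q p) x| ≤ 3 * (1 + aPrioriBound a b c) / d + d / 2 * N := by
  have hsub : ball x (2 * d) ⊆ Omega := by
    intro y hy
    have h1 : ‖x - y‖ < 2 * d := by rwa [← dist_eq_norm, dist_comm]
    have h2 := norm_sub_norm_le x y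
    show 1 < ‖y‖
    linarith
  exact abs_partialD_le_of_ball k hd ((h.regular.contDiffOn_entry p).mono hsub)
    (fun y hy => h.abs_entry_le hc p (Omega_subset_OmegaBar (hsub hy)))
    (fun y hy => (h.abs_laplacian_le ha hb hc p (hsub hy)).trans_lt hN)

theorem integrableOn_dirichletDensity (h : IsSolution a b c L W Q) :
    IntegrableOn (dirichletDensity (entry Q)) Omega :=
  h.mem.2.1.congr_fun (fun _ hx => gradSq_eq_dirichletDensity Q hx) isOpen_Omega.measurableSet

theorem integrableOn_fpot (h : IsSolution a b c L W Q) :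
    IntegrableOn (fun x => fpot a b c (Q x)) Omega := by
  refine (h.finiteEnergy.sub (h.mem.2.1.const_mul (L / 2))).congr_fun (fun x _ => ?_)
    isOpen_Omega.measurableSet
  simp

end IsSolution

/-- Entries of the deviation of a configuration from its far-field value. -/
def deviation (a b c : ℝ) (Q : E3 → Mat3) (p : Fin 3 × Fin 3) (x : E3) : ℝ :=
  entry Q p x - Qinf a b c p.1 p.2

theorem partialD_deviation (a b c : ℝ) (Q : E3 → Mat3) (p : Fin 3 × Fin 3) (k : Fin 3) :
    partialD k (deviation a b c Q p) = partialD k (entry Q p) := by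
  ext x
  unfold partialD deviation
  rw [fderiv_sub_const]

theorem dirichletDensity_deviation (a b c : ℝ) (Q : E3 → Mat3) :
    dirichletDensity (deviation a b c Q) = dirichletDensity (entry Q) := by
  ext x
  simp only [dirichletDensity, partialD_deviation]

theorem Qinf_isSymm (a b c : ℝ) : (Qinf a b c).IsSymm := by
  ext i j
  simp [Qinf, outer, Matrix.one_apply, mul_comm, eq_comm]

theorem mnormSq_sub_Qinf {a b c : ℝ} {Q : E3 → Mat3} {x : E3} (h : (Q x).IsSymm) :
    mnormSq (Q x - Qinf a b c) = ∑ p, deviation a b c Q p x ^ 2 := by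
  rw [mnormSq_eq_sum (h.sub (Qinf_isSymm a b c)), Fintype.sum_prod_type]
  rfl

/-- Uniform weighted `L²` bound for the deviation of solutions from the far-field value. -/
theorem exists_integral_deviation_le {a b c : ℝ} (ha : 0 ≤ a) (hb : 0 < b) (hc : 0 < c) :
    ∃ K : ℝ, 0 ≤ K ∧ ∀ (L W : ℝ) (Q : E3 → Mat3), IsSolution a b c L W Q → 1 ≤ L →
      IntegrableOn (fun x => innerCutoff x * ((∑ p, deviation a b c Q p x ^ 2) / ‖x‖ ^ 2)) Omega ∧
      ∫ x in Omega, innerCutoff x * ((∑ p, deviation a b c Q p x ^ 2) / ‖x‖ ^ 2) ≤ K := by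
  obtain ⟨K₁, hK₁, hpoh⟩ := exists_pohozaev_bound
  obtain ⟨K₂, hK₂, hhardy⟩ := exists_hardy_bound
  set M := aPrioriBound a b c with hM
  have hM0 : 0 ≤ M := aPrioriBound_nonneg a b c
  set D : ℝ := 3 * (1 + M) / (1 / 10) + (1 / 10) / 2 * (gradfBound a b c + 1) with hD
  have hG := gradfBound_nonneg ha hb hc
  have hD0 : 0 ≤ D := by positivity
  set E : ℝ := b ^ 2 / (2 * c) * M + c * M ^ 2 + |Cconst a b c| with hE
  have hE0 : 0 ≤ E := by positivity
  set P : ℝ := ∑ p : Fin 3 × Fin 3, Qinf a b c p.1 p.2 ^ 2 with hP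
  have hP0 : 0 ≤ P := Finset.sum_nonneg fun _ _ => sq_nonneg _
  refine ⟨4 * (K₁ * (27 * D ^ 2 + E)) + K₂ * (2 * M + 2 * P), by positivity, ?_⟩
  intro L W Q h hL1
  have hL0 := h.elastic_pos
  have hq := h.regular.contDiffOn_entry
  have hGL : gradfBound a b c / L < gradfBound a b c + 1 :=
    (div_le_self hG hL1).trans_lt (by linarith)
  have hUi : IntegrableOn (fun x => (∑ p, deviation a b c Q p x ^ 2) / ‖x‖ ^ 2) Omega :=
    h.mem.2.2.congr_fun (fun x hx => by
      simp only [mnormSq_sub_Qinf (h.mem.1 x (Omega_subset_OmegaBar hx)).1])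
      isOpen_Omega.measurableSet
  refine ⟨integrableOn_innerCutoff_mul hUi, ?_⟩
  have hS := hpoh (entry Q) (fun x => fpot a b c (Q x) / L) (27 * D ^ 2 + E) hq
    ((contDiffOn_fpot hq).div_const L) ?_ ?_ h.integrableOn_dirichletDensity
    (h.integrableOn_fpot.div_const L) ?_
  · have hU := hhardy (deviation a b c Q) (2 * M + 2 * P)
      (fun p => ((hq p).of_le (by norm_num)).sub contDiffOn_const)
      (by rw [dirichletDensity_deviation]; exact h.integrableOn_dirichletDensity) hUi ?_
    · rw [dirichletDensity_deviation] at hU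
      linarith
    · intro x h2 h3
      have hx : x ∈ OmegaBar := show 1 ≤ ‖x‖ by nlinarith [norm_nonneg x]
      have h1 : ∑ p, deviation a b c Q p x ^ 2 ≤
          ∑ p, (2 * entry Q p x ^ 2 + 2 * Qinf a b c p.1 p.2 ^ 2) := by
        refine Finset.sum_le_sum fun p _ => ?_
        unfold deviation
        nlinarith [sq_nonneg (entry Q p x + Qinf a b c p.1 p.2)]
      rw [Finset.sum_add_distrib, ← Finset.mul_sum, ← Finset.mul_sum,
        ← mnormSq_eq_sum_entry (h.mem.1 x hx).1] at h1
      have := h.mnormSq_le hc hx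
      linarith
  · intro x hx
    exact div_nonneg (fpot_nonneg hc (h.mem.1 x (Omega_subset_OmegaBar hx))) hL0.le
  · intro x hx j
    have hF : DifferentiableAt ℝ (fun y => fpot a b c (Q y)) x := ((contDiffOn_fpot hq).contDiffAt
      (isOpen_Omega.mem_nhds hx)).differentiableAt (by norm_num)
    have h1 : partialD j (fun x => fpot a b c (Q x) / L) x =
        partialD j (fun x => fpot a b c (Q x)) x / L :=
      partialD_eq_of_hasDerivAt (by simp only [div_eq_mul_inv]; exact hF.mul_const _)
        ((hasDerivAt_along_zero hF).div_const L)
    rw [h1, partialD_fpot hq h.mem.1 hx, Finset.sum_div]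
    refine Finset.sum_congr rfl fun p _ => ?_
    rw [h.eulerLagrange.laplacian_entry hL0 hx]
    ring
  · intro x h2 h3
    have hx : 1 + 2 * (1 / 10 : ℝ) ≤ ‖x‖ := by nlinarith [norm_nonneg x]
    have hxO : x ∈ OmegaBar := show 1 ≤ ‖x‖ by linarith
    constructor
    · have h1 : ∀ p k, partialD k (entry Q p) x ^ 2 ≤ D ^ 2 := fun p k => by
        rw [← sq_abs]
        exact pow_le_pow_left₀ (abs_nonneg _)
          (h.abs_partialD_le ha hb hc p k (by norm_num) hx hGL) 2
      calc dirichletDensity (entry Q) x ≤ ∑ _p : Fin 3 × Fin 3, ∑ _k : Fin 3, D ^ 2 :=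
            Finset.sum_le_sum fun p _ => Finset.sum_le_sum fun k _ => h1 p k
        _ = 27 * D ^ 2 := by simp; ring
        _ ≤ _ := by linarith
    · have h1 := fpot_nonneg (a := a) (b := b) hc (h.mem.1 x hxO)
      have h4 := fpot_le (b := b) ha hc (h.mem.1 x hxO) (h.mnormSq_le hc hxO)
      have h5 : fpot a b c (Q x) / L ≤ fpot a b c (Q x) := div_le_self h1 hL1
      have : 0 ≤ 27 * D ^ 2 := by positivity
      linarith

theorem norm_fderiv_le_of_abs_partialD_le {f : E3 → ℝ} {x : E3} {C : ℝ}
    (h : ∀ k, |partialD k f x| ≤ C) : ‖fderiv ℝ f x‖ ≤ 3 * C := by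
  have hC : 0 ≤ C := (abs_nonneg _).trans (h 0)
  refine ContinuousLinearMap.opNorm_le_bound _ (by positivity) fun v => ?_
  have hv : v = ∑ k, v k • (EuclideanSpace.single k 1 : E3) := by
    ext i
    simp [Fin.sum_univ_three, PiLp.single_apply]
    fin_cases i <;> simp
  have h1 : fderiv ℝ f x v = ∑ k, v k * partialD k f x := by
    conv_lhs => rw [hv]
    simp [partialD]
  rw [h1]
  refine (norm_sum_le _ _).trans ?_
  calc _ ≤ ∑ _k : Fin 3, ‖v‖ * C := Finset.sum_le_sum fun k _ => by
        rw [norm_mul]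
        exact mul_le_mul (abs_coord_le_norm v k) (h k) (norm_nonneg _) (norm_nonneg _)
    _ = _ := by simp; ring

theorem IsSolution.abs_deviation_sub_le {a b c L W : ℝ} {Q : E3 → Mat3}
    (h : IsSolution a b c L W Q) (ha : 0 ≤ a) (hb : 0 < b) (hc : 0 < c) {R : ℝ} (hR : 8 ≤ R)
    (hL : R ^ 2 ≤ L) {x y : E3} (hx : ‖x‖ = R) (hy : y ∈ ball x (R / 2)) (p : Fin 3 × Fin 3) :
    |deviation a b c Q p y - deviation a b c Q p x| ≤
      3 * ((24 * (1 + aPrioriBound a b c) + gradfBound a b c + 1) / R) * ‖y - x‖ := by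
  have hM := aPrioriBound_nonneg a b c
  have hG := gradfBound_nonneg ha hb hc
  have hR0 : 0 < R := by linarith
  have hfar : ∀ z ∈ ball x (R / 2), R / 2 ≤ ‖z‖ := by
    intro z hz
    have h1 : ‖x - z‖ < R / 2 := by rwa [← dist_eq_norm, dist_comm]
    have h2 := norm_sub_norm_le x z
    linarith
  have hmem : ∀ z ∈ ball x (R / 2), z ∈ Omega := fun z hz => by
    have := hfar z hz
    show 1 < ‖z‖
    linarith
  have hN : gradfBound a b c / L < (gradfBound a b c + 1) / R ^ 2 := by
    have h1 : gradfBound a b c / L ≤ gradfBound a b c / R ^ 2 :=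
      div_le_div_of_nonneg_left hG (by positivity) hL
    exact h1.trans_lt (div_lt_div_of_pos_right (by linarith) (by positivity))
  have hp : ∀ z ∈ ball x (R / 2), ‖fderiv ℝ (deviation a b c Q p) z‖ ≤
      3 * ((24 * (1 + aPrioriBound a b c) + gradfBound a b c + 1) / R) := by
    intro z hz
    refine norm_fderiv_le_of_abs_partialD_le fun k => ?_
    rw [partialD_deviation]
    refine (h.abs_partialD_le ha hb hc p k (d := R / 8) (by positivity)
      (by linarith [hfar z hz]) hN).trans ?_
    have e : 3 * (1 + aPrioriBound a b c) / (R / 8) +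
        R / 8 / 2 * ((gradfBound a b c + 1) / R ^ 2) =
        (24 * (1 + aPrioriBound a b c) + (gradfBound a b c + 1) / 16) / R := by
      field_simp; ring
    rw [e]
    exact div_le_div_of_nonneg_right (by linarith) hR0.le
  refine (convex_ball x (R / 2)).norm_image_sub_le_of_norm_fderiv_le (𝕜 := ℝ) (fun z hz => ?_) hp
    (mem_ball_self (by positivity)) hy
  exact ((((h.regular.contDiffOn_entry p).contDiffAt
    (isOpen_Omega.mem_nhds (hmem z hz))).differentiableAt (by norm_num)).sub_const _)

/-- Uniform decay at infinity of solutions with large elastic constant. -/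
theorem exists_radius_abs_deviation_le {a b c : ℝ} (ha : 0 ≤ a) (hb : 0 < b) (hc : 0 < c)
    {δ : ℝ} (hδ : 0 < δ) : ∃ R₀ : ℝ, 8 ≤ R₀ ∧ ∀ R, R₀ ≤ R → ∀ (L W : ℝ) (Q : E3 → Mat3),
      IsSolution a b c L W Q → R ^ 2 ≤ L → ∀ x : E3, ‖x‖ = R → ∀ p,
      |deviation a b c Q p x| ≤ δ := by
  obtain ⟨K, hK0, hK⟩ := exists_integral_deviation_le ha hb hc
  have hM := aPrioriBound_nonneg a b c
  have hG := gradfBound_nonneg ha hb hc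
  set A : ℝ := 24 * (1 + aPrioriBound a b c) + gradfBound a b c + 1 with hA
  have hA0 : 0 < A := by positivity
  set τ : ℝ := min (1 / 2) (δ / (6 * A)) with hτ
  have hτ0 : 0 < τ := by positivity
  set V : ℝ := (volume : Measure E3).real (ball 0 1) with hV
  have hV0 : 0 < V := ENNReal.toReal_pos (measure_ball_pos _ _ one_pos).ne' measure_ball_lt_top.ne
  refine ⟨max 8 (16 * K / (δ ^ 2 * τ ^ 3 * V) + 1), le_max_left _ _, ?_⟩
  intro R hR L W Q h hL x hx p
  have hR8 : 8 ≤ R := (le_max_left _ _).trans hR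
  have hRK : 16 * K / (δ ^ 2 * τ ^ 3 * V) < R := by
    have := (le_max_right _ _).trans hR
    linarith
  have hR0 : 0 < R := by linarith
  rw [div_lt_iff₀ (by positivity)] at hRK
  by_contra! hlt
  obtain ⟨hInt, hle⟩ := hK L W Q h (by nlinarith)
  have hsub : ball x (τ * R) ⊆ ball x (R / 2) :=
    ball_subset_ball (by have := min_le_left (1 / 2) (δ / (6 * A)); nlinarith)
  have hfar : ∀ z ∈ ball x (R / 2), R / 2 ≤ ‖z‖ ∧ ‖z‖ ≤ 2 * R := by
    intro z hz
    have h1 : ‖x - z‖ < R / 2 := by rwa [← dist_eq_norm, dist_comm]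
    have h2 := norm_sub_norm_le x z
    have h3 := norm_sub_norm_le z x
    rw [norm_sub_rev] at h3
    constructor <;> linarith
  have hlow : ∀ y ∈ ball x (τ * R), δ ^ 2 / (16 * R ^ 2) ≤
      innerCutoff y * ((∑ p, deviation a b c Q p y ^ 2) / ‖y‖ ^ 2) := by
    intro y hy
    obtain ⟨h1, h2⟩ := hfar y (hsub hy)
    have hy' : ‖y - x‖ < τ * R := by rwa [← dist_eq_norm]
    have h3 := h.abs_deviation_sub_le ha hb hc hR8 hL hx (hsub hy) p
    have h4 : 3 * (A / R) * ‖y - x‖ ≤ δ / 2 := by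
      calc 3 * (A / R) * ‖y - x‖ ≤ 3 * (A / R) * (τ * R) := by gcongr
        _ = 3 * A * τ := by field_simp
        _ ≤ 3 * A * (δ / (6 * A)) := by gcongr; exact min_le_right _ _
        _ = δ / 2 := by field_simp; norm_num
    have h5 : δ / 2 ≤ |deviation a b c Q p y| := by
      have := abs_sub_abs_le_abs_sub (deviation a b c Q p x) (deviation a b c Q p y)
      rw [abs_sub_comm] at this
      linarith
    have h6 : δ ^ 2 / 4 ≤ ∑ p, deviation a b c Q p y ^ 2 := by
      refine le_trans ?_ (Finset.single_le_sum (f := fun p => deviation a b c Q p y ^ 2)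
        (fun _ _ => sq_nonneg _) (Finset.mem_univ p))
      rw [← sq_abs (deviation a b c Q p y)]
      nlinarith
    rw [innerCutoff_eq_one (by nlinarith), one_mul]
    calc δ ^ 2 / (16 * R ^ 2) = (δ ^ 2 / 4) / (2 * R) ^ 2 := by field_simp; norm_num
      _ ≤ _ := by
        have hy0 : 0 < ‖y‖ := by linarith
        gcongr
  have hsubO : ball x (τ * R) ⊆ Omega := fun y hy => by
    have := (hfar y (hsub hy)).1
    show 1 < ‖y‖
    linarith
  have hvol : (volume : Measure E3).real (ball x (τ * R)) = (τ * R) ^ 3 * V := by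
    rw [Measure.real, Measure.addHaar_ball_of_pos _ x (by positivity), ENNReal.toReal_mul,
      ENNReal.toReal_ofReal (by positivity)]
    simp [hV, Measure.real]
  have h1 : δ ^ 2 / (16 * R ^ 2) * ((τ * R) ^ 3 * V) ≤
      ∫ y in ball x (τ * R), innerCutoff y * ((∑ p, deviation a b c Q p y ^ 2) / ‖y‖ ^ 2) := by
    rw [← hvol, mul_comm, ← smul_eq_mul, ← setIntegral_const]
    exact setIntegral_mono_on (integrableOn_const measure_ball_lt_top.ne)
      (hInt.mono_set hsubO) measurableSet_ball hlow
  have h2 := setIntegral_mono_set hInt (ae_of_all _ fun y =>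
    mul_nonneg (innerCutoff_nonneg y) (div_nonneg (Finset.sum_nonneg fun p _ =>
      sq_nonneg (deviation a b c Q p y)) (sq_nonneg ‖y‖))) (LE.le.eventuallyLE hsubO)
  have h3 : δ ^ 2 / (16 * R ^ 2) * ((τ * R) ^ 3 * V) = R * (δ ^ 2 * τ ^ 3 * V) / 16 := by
    field_simp
  linarith

/-- Model harmonic function: a constant, a quadrupole of order `r⁻³` and a monopole of order
`r⁻¹`. -/
def quadField (A B C : ℝ) (i j : Fin 3) (x : E3) : ℝ :=
  C + A * (x i * x j * ‖x‖⁻¹ ^ 5 - (1 : Mat3) i j / 3 * ‖x‖⁻¹ ^ 3) - B * ‖x‖⁻¹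

theorem contDiffAt_norm_inv {x : E3} (hx : x ≠ 0) {n : WithTop ℕ∞} :
    ContDiffAt ℝ n (fun y : E3 => ‖y‖⁻¹) x :=
  (contDiffAt_norm ℝ hx).inv (norm_ne_zero_iff.2 hx)

theorem ne_zero_of_mem_OmegaBar {x : E3} (hx : x ∈ OmegaBar) : x ≠ 0 :=
  norm_pos_iff.1 (lt_of_lt_of_le one_pos hx)

theorem hasDerivAt_norm_inv_along {x : E3} (hx : x ≠ 0) (k : Fin 3) :
    HasDerivAt (fun t : ℝ => ‖x + t • (EuclideanSpace.single k 1 : E3)‖⁻¹)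
      (-(x k * ‖x‖⁻¹ ^ 3)) 0 := by
  have hx0 : 0 < ‖x‖ := norm_pos_iff.2 hx
  have h1 := (hasDerivAt_normSq_along x k 0).sqrt (by simpa using hx0.ne')
  have h2 := h1.fun_inv (by simpa using hx0.ne')
  have e : (fun t : ℝ => ‖x + t • (EuclideanSpace.single k 1 : E3)‖⁻¹) =
      fun t => (√(‖x + t • (EuclideanSpace.single k 1 : E3)‖ ^ 2))⁻¹ := by
    ext t; rw [Real.sqrt_sq (norm_nonneg _)]
  rw [e]
  refine h2.congr_deriv ?_
  simp only [zero_smul, add_zero, Real.sqrt_sq (norm_nonneg _)]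
  field_simp

theorem contDiffAt_quadField (A B C : ℝ) (i j : Fin 3) {x : E3} (hx : x ≠ 0) {n : WithTop ℕ∞} :
    ContDiffAt ℝ n (quadField A B C i j) x := by
  have hν := contDiffAt_norm_inv hx (n := n)
  have hc : ∀ i : Fin 3, ContDiffAt ℝ n (fun y : E3 => y i) x := fun i => by fun_prop
  exact (contDiffAt_const.add (contDiffAt_const.mul ((((hc i).mul (hc j)).mul (hν.pow 5)).sub
    (contDiffAt_const.mul (hν.pow 3))))).sub (contDiffAt_const.mul hν)

theorem partialD_quadField (A B C : ℝ) (i j k : Fin 3) {x : E3} (hx : x ≠ 0) :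
    partialD k (quadField A B C i j) x =
      A * (((if i = k then 1 else 0) * x j + x i * (if j = k then 1 else 0)) * ‖x‖⁻¹ ^ 5 -
        5 * (x i * x j * x k) * ‖x‖⁻¹ ^ 7 + (1 : Mat3) i j * x k * ‖x‖⁻¹ ^ 5) +
      B * (x k * ‖x‖⁻¹ ^ 3) := by
  have hν := hasDerivAt_norm_inv_along hx k
  have hi := hasDerivAt_coord_along x i k 0
  have hj := hasDerivAt_coord_along x j k 0
  refine partialD_eq_of_hasDerivAt ((contDiffAt_quadField A B C i j hx
    (n := 1)).differentiableAt (by norm_num)) ?_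
  refine (((((hi.fun_mul hj).fun_mul (hν.fun_pow 5)).fun_sub
    ((hν.fun_pow 3).const_mul ((1 : Mat3) i j / 3))).const_mul A).const_add C |>.fun_sub
      (hν.const_mul B)).congr_deriv ?_
  simp only [zero_smul, add_zero]
  push_cast
  ring

theorem laplacian_quadField (A B C : ℝ) (i j : Fin 3) {x : E3} (hx : x ∈ Omega) :
    ∑ k, partialD k (partialD k (quadField A B C i j)) x = 0 := by
  have hx' := ne_zero_of_mem_OmegaBar (Omega_subset_OmegaBar hx)
  have hx0 : 0 < ‖x‖ := norm_pos_iff.2 hx'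
  have key : ∀ k, partialD k (partialD k (quadField A B C i j)) x =
      A * ((2 * (if i = k then 1 else 0) * (if j = k then 1 else 0)) * ‖x‖⁻¹ ^ 5 -
        5 * ((if i = k then 1 else 0) * x j + x i * (if j = k then 1 else 0)) * x k * ‖x‖⁻¹ ^ 7 -
        5 * ((if i = k then 1 else 0) * x j * x k + x i * (if j = k then 1 else 0) * x k +
          x i * x j) * ‖x‖⁻¹ ^ 7 +
        35 * (x i * x j * x k ^ 2) * ‖x‖⁻¹ ^ 9 + (1 : Mat3) i j * ‖x‖⁻¹ ^ 5 -
        5 * (1 : Mat3) i j * x k ^ 2 * ‖x‖⁻¹ ^ 7) +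
      B * (‖x‖⁻¹ ^ 3 - 3 * x k ^ 2 * ‖x‖⁻¹ ^ 5) := by
    intro k
    have hν := hasDerivAt_norm_inv_along hx' k
    have hi := hasDerivAt_coord_along x i k 0
    have hj := hasDerivAt_coord_along x j k 0
    have hk := hasDerivAt_coord_along x k k 0
    rw [partialD_congr (fun y hy => partialD_quadField A B C i j k
      (ne_zero_of_mem_OmegaBar (Omega_subset_OmegaBar hy))) k hx]
    refine partialD_eq_of_hasDerivAt ?_ ?_
    · have h1 := (contDiffAt_norm_inv hx' (n := 1)).differentiableAt (by norm_num)
      have hc : ∀ i : Fin 3, DifferentiableAt ℝ (fun y : E3 => y i) x := fun i => by fun_prop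
      fun_prop
    · refine (((((((hj.const_mul (if i = k then 1 else 0)).fun_add
        (hi.mul_const (if j = k then 1 else 0))).fun_mul (hν.fun_pow 5)).fun_sub
          ((((hi.fun_mul hj).fun_mul hk).const_mul 5).fun_mul (hν.fun_pow 7))).fun_add
            ((hk.const_mul ((1 : Mat3) i j)).fun_mul (hν.fun_pow 5))).const_mul A).fun_add
              ((hk.fun_mul (hν.fun_pow 3)).const_mul B)).congr_deriv ?_
      simp only [zero_smul, add_zero, if_true]
      push_cast
      ring
  have hrel : (x 0 ^ 2 + x 1 ^ 2 + x 2 ^ 2) * ‖x‖⁻¹ ^ 2 - 1 = 0 := by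
    have := sum_coord_sq x
    rw [Fin.sum_univ_three] at this
    rw [this]
    field_simp
    ring
  have hfac : ∑ k, partialD k (partialD k (quadField A B C i j)) x =
      (A * (35 * x i * x j * ‖x‖⁻¹ ^ 7 - 5 * (1 : Mat3) i j * ‖x‖⁻¹ ^ 5) -
        3 * B * ‖x‖⁻¹ ^ 3) * ((x 0 ^ 2 + x 1 ^ 2 + x 2 ^ 2) * ‖x‖⁻¹ ^ 2 - 1) := by
    rw [Finset.sum_congr rfl fun k _ => key k, Fin.sum_univ_three]
    fin_cases i <;> fin_cases j <;> simp <;> ring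
  rw [hfac, hrel, mul_zero]

theorem continuousOn_quadField (A B C : ℝ) (i j : Fin 3) :
    ContinuousOn (quadField A B C i j) OmegaBar := fun _ hx =>
  (contDiffAt_quadField A B C i j (ne_zero_of_mem_OmegaBar hx)
    (n := 0)).continuousAt.continuousWithinAt

theorem hasDerivWithinAt_radial_quadField (A B C : ℝ) (i j : Fin 3) {x : E3} (hx : ‖x‖ = 1) :
    HasDerivWithinAt (fun t : ℝ => quadField A B C i j (x + t • x))
      (-3 * A * (x i * x j - (1 : Mat3) i j / 3) + B) (Ici 0) 0 := by
  have h1 : HasDerivAt (fun t : ℝ => (1 + t)⁻¹) (-1) 0 := by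
    refine (((hasDerivAt_id (0 : ℝ)).const_add 1).fun_inv (by norm_num)).congr_deriv ?_
    norm_num
  have h2 := ((((h1.fun_pow 3).const_mul (A * (x i * x j - (1 : Mat3) i j / 3))).const_add
    C).fun_sub (h1.const_mul B)).hasDerivWithinAt (s := Ici 0)
  have e : EqOn (fun t : ℝ => quadField A B C i j (x + t • x))
      (fun t => C + A * (x i * x j - (1 : Mat3) i j / 3) * (1 + t)⁻¹ ^ 3 - B * (1 + t)⁻¹)
      (Ici 0) := by
    intro t ht
    have ht' : (0 : ℝ) ≤ t := ht
    have hn : ‖x + t • x‖ = 1 + t := by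
      rw [show x + t • x = (1 + t) • x by rw [add_smul, one_smul], norm_smul, hx,
        Real.norm_of_nonneg (by linarith), mul_one]
    have h0 : (1 + t) ≠ 0 := by positivity
    simp only [quadField, hn, PiLp.add_apply, PiLp.smul_apply, smul_eq_mul]
    field_simp
  refine (h2.congr e (e (self_mem_Ici))).congr_deriv ?_
  norm_num
  ring

/-- Entries of the traceless projection `u ⊗ u - I / 3`. -/
def projEntry (u : E3) (i j : Fin 3) : ℝ := u i * u j - 1 / 3 * (1 : Mat3) i j

theorem abs_projEntry_le {u : E3} (hu : ‖u‖ ≤ 1) (i j : Fin 3) : |projEntry u i j| ≤ 2 := by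
  have h1 : |u i * u j| ≤ 1 := by
    rw [abs_mul]
    exact mul_le_one₀ ((abs_coord_le_norm u i).trans hu) (abs_nonneg _)
      ((abs_coord_le_norm u j).trans hu)
  have h2 : |1 / 3 * (1 : Mat3) i j| ≤ 1 := by
    rw [Matrix.one_apply]
    split_ifs <;> norm_num
  calc |projEntry u i j| ≤ |u i * u j| + |1 / 3 * (1 : Mat3) i j| := abs_sub _ _
    _ ≤ 2 := by linarith

theorem norm_er_le (x : E3) : ‖er x‖ ≤ 1 := by
  rw [er, norm_smul, norm_inv, norm_norm]
  exact inv_mul_le_one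

theorem norm_ez_le : ‖ez‖ ≤ 1 := by
  simp [ez]

theorem Qinf_apply (a b c : ℝ) (i j : Fin 3) :
    Qinf a b c i j = sstar a b c * projEntry ez i j := rfl

theorem Q0_apply (a b c : ℝ) (w : ℝ≥0∞) (x : E3) (i j : Fin 3) :
    Q0 a b c w x i j = sstar a b c * coef3 w / ‖x‖ ^ 3 * projEntry (er x) i j +
      sstar a b c * (1 - coef1 w / ‖x‖) * projEntry ez i j := rfl

theorem Q0_eq_quadField (a b c : ℝ) (w : ℝ≥0∞) (x : E3) (i j : Fin 3) :
    Q0 a b c w x i j = quadField (sstar a b c * coef3 w) (sstar a b c * coef1 w * projEntry ez i j)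
      (sstar a b c * projEntry ez i j) i j x := by
  rw [Q0_apply, quadField, projEntry, er]
  simp only [PiLp.smul_apply, smul_eq_mul, div_eq_mul_inv, inv_pow]
  ring

theorem abs_Q0_sub_le (a b c : ℝ) (w w' : ℝ≥0∞) {x : E3} (hx : 1 ≤ ‖x‖) (i j : Fin 3) :
    |Q0 a b c w x i j - Q0 a b c w' x i j| ≤
      2 * |sstar a b c| * (|coef3 w - coef3 w'| + |coef1 w - coef1 w'|) := by
  have hr : |‖x‖⁻¹| ≤ 1 := by
    rw [abs_of_nonneg (by positivity)]; exact inv_le_one_of_one_le₀ hx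
  have hr3 : |‖x‖⁻¹ ^ 3| ≤ 1 := by rw [abs_pow]; exact pow_le_one₀ (abs_nonneg _) hr
  have e : Q0 a b c w x i j - Q0 a b c w' x i j =
      sstar a b c * ((coef3 w - coef3 w') * (‖x‖⁻¹ ^ 3 * projEntry (er x) i j) -
        (coef1 w - coef1 w') * (‖x‖⁻¹ * projEntry ez i j)) := by
    rw [Q0_apply, Q0_apply]
    simp only [div_eq_mul_inv, inv_pow]
    ring
  have h1 : |‖x‖⁻¹ ^ 3 * projEntry (er x) i j| ≤ 2 := by
    rw [abs_mul]
    nlinarith [abs_projEntry_le (norm_er_le x) i j, abs_nonneg (projEntry (er x) i j)]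
  have h2 : |‖x‖⁻¹ * projEntry ez i j| ≤ 2 := by
    rw [abs_mul]
    nlinarith [abs_projEntry_le norm_ez_le i j, abs_nonneg (projEntry ez i j)]
  rw [e, abs_mul]
  have h3 : |(coef3 w - coef3 w') * (‖x‖⁻¹ ^ 3 * projEntry (er x) i j) -
      (coef1 w - coef1 w') * (‖x‖⁻¹ * projEntry ez i j)| ≤
      2 * (|coef3 w - coef3 w'| + |coef1 w - coef1 w'|) := by
    refine (abs_sub _ _).trans ?_
    rw [abs_mul, abs_mul (coef1 w - coef1 w')]
    nlinarith [abs_nonneg (coef3 w - coef3 w'), abs_nonneg (coef1 w - coef1 w')]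
  nlinarith [abs_nonneg (sstar a b c)]

theorem coef1_ofReal {ω : ℝ} (hω : 0 ≤ ω) : coef1 (ENNReal.ofReal ω) = ω / (1 + ω) := by
  simp [coef1, hω]

theorem coef3_ofReal {ω : ℝ} (hω : 0 ≤ ω) : coef3 (ENNReal.ofReal ω) = ω / (3 + ω) := by
  simp [coef3, hω]

theorem abs_Q0_sub_Qinf_le (a b c : ℝ) {ω : ℝ} (hω : 0 < ω) {x : E3} (hx : 1 ≤ ‖x‖)
    (i j : Fin 3) :
    |Q0 a b c (ENNReal.ofReal ω) x i j - Qinf a b c i j| ≤ 4 * |sstar a b c| / ‖x‖ := by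
  have hx0 : 0 < ‖x‖ := by linarith
  have c3 : |ω / (3 + ω)| ≤ 1 := by
    rw [abs_of_pos (by positivity), div_le_one (by positivity)]; linarith
  have c1 : |ω / (1 + ω)| ≤ 1 := by
    rw [abs_of_pos (by positivity), div_le_one (by positivity)]; linarith
  have e : Q0 a b c (ENNReal.ofReal ω) x i j - Qinf a b c i j =
      sstar a b c * (ω / (3 + ω) * (‖x‖⁻¹ ^ 2 * projEntry (er x) i j) -
        ω / (1 + ω) * projEntry ez i j) / ‖x‖ := by
    rw [Q0_apply, Qinf_apply, coef1_ofReal hω.le, coef3_ofReal hω.le]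
    field_simp
    ring
  have hr : ‖x‖⁻¹ ≤ 1 := inv_le_one_of_one_le₀ hx
  have h1 : |‖x‖⁻¹ ^ 2 * projEntry (er x) i j| ≤ 2 := by
    rw [abs_mul, abs_of_nonneg (by positivity)]
    have : ‖x‖⁻¹ ^ 2 ≤ 1 := pow_le_one₀ (by positivity) hr
    nlinarith [abs_projEntry_le (norm_er_le x) i j, abs_nonneg (projEntry (er x) i j)]
  have h2 := abs_projEntry_le norm_ez_le i j
  have h3 : |ω / (3 + ω) * (‖x‖⁻¹ ^ 2 * projEntry (er x) i j) -
      ω / (1 + ω) * projEntry ez i j| ≤ 4 := by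
    refine (abs_sub _ _).trans ?_
    rw [abs_mul, abs_mul (ω / (1 + ω))]
    nlinarith [abs_nonneg (ω / (3 + ω)), abs_nonneg (ω / (1 + ω))]
  rw [e, abs_div, abs_mul, abs_of_pos hx0, mul_comm 4]
  gcongr

theorem Q0_robin_identity {ω : ℝ} (hω : 0 < ω) (s P e q : ℝ) :
    ω * (q - s * P) - (-3 * (s * (ω / (3 + ω))) * P + s * (ω / (1 + ω)) * e) =
      ω * (q - (s * e + s * (ω / (3 + ω)) * P - s * (ω / (1 + ω)) * e)) := by
  field_simp
  ring

/-- Comparison of a solution with the explicit harmonic configuration carrying the same anchoring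
strength. -/
theorem IsSolution.abs_entry_sub_Q0_le {a b c L W : ℝ} {Q : E3 → Mat3}
    (h : IsSolution a b c L W Q) (ha : 0 ≤ a) (hb : 0 < b) (hc : 0 < c) {ε R : ℝ} (hε : 0 ≤ ε)
    (hR : 1 < R) (p : Fin 3 × Fin 3)
    (hout : ∀ x, ‖x‖ = R →
      |entry Q p x - Q0 a b c (ENNReal.ofReal (W / L)) x p.1 p.2| ≤ ε)
    {x : E3} (hx1 : 1 ≤ ‖x‖) (hxR : ‖x‖ ≤ R) :
    |entry Q p x - Q0 a b c (ENNReal.ofReal (W / L)) x p.1 p.2| ≤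
      ε + (gradfBound a b c + 1) / L * R ^ 2 := by
  have hL := h.elastic_pos
  have hω : 0 < W / L := div_pos h.anchoring_pos hL
  set ω := W / L with hωdef
  have hG := gradfBound_nonneg ha hb hc
  set s := sstar a b c with hs
  set f := quadField (s * (ω / (3 + ω))) (s * (ω / (1 + ω)) * projEntry ez p.1 p.2)
    (s * projEntry ez p.1 p.2) p.1 p.2 with hf
  have hQ0 : ∀ y, Q0 a b c (ENNReal.ofReal ω) y p.1 p.2 = f y := fun y => by
    rw [Q0_eq_quadField, coef1_ofReal hω.le, coef3_ofReal hω.le]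
  simp only [hQ0] at hout ⊢
  have hq2 : ContDiffOn ℝ 2 (entry Q p) Omega := h.regular.contDiffOn_entry p
  have hf2 : ContDiffOn ℝ 2 f Omega := fun y hy =>
    (contDiffAt_quadField _ _ _ _ _
      (ne_zero_of_mem_OmegaBar (Omega_subset_OmegaBar hy))).contDiffWithinAt
  have key : ∀ σ : ℝ, |σ| = 1 → σ * (entry Q p x - f x) ≤
      ε + (gradfBound a b c + 1) / L * R ^ 2 := by
    intro σ hσ
    have hpd : ∀ (u v : E3 → ℝ) (k : Fin 3), ContDiffOn ℝ 1 u Omega → ContDiffOn ℝ 1 v Omega →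
        ∀ y ∈ Omega, partialD k (fun z => σ * (u z - v z)) y =
          σ * (partialD k u y - partialD k v y) := by
      intro u v k hu hv y hy
      have hu' := (hu.contDiffAt (isOpen_Omega.mem_nhds hy)).differentiableAt (by norm_num)
      have hv' := (hv.contDiffAt (isOpen_Omega.mem_nhds hy)).differentiableAt (by norm_num)
      exact partialD_eq_of_hasDerivAt ((hu'.fun_sub hv').const_mul σ)
        (((hasDerivAt_along_zero (k := k) hu').fun_sub
          (hasDerivAt_along_zero (k := k) hv')).const_mul σ)
    refine robin_comparison (v := fun y => σ * (entry Q p y - f y)) hω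
      (by positivity) hε hR ?_ (contDiffOn_const.mul (hq2.sub hf2)) ?_ ?_ ?_ hx1 hxR
    · exact continuousOn_const.mul ((h.regular.continuousOn_entry p).sub
        (continuousOn_quadField _ _ _ _ _))
    · intro y hy _
      have e : ∑ k, partialD k (partialD k fun z => σ * (entry Q p z - f z)) y =
          σ * ∑ k, partialD k (partialD k (entry Q p)) y := by
        have h0 := laplacian_quadField (s * (ω / (3 + ω)))
          (s * (ω / (1 + ω)) * projEntry ez p.1 p.2) (s * projEntry ez p.1 p.2) p.1 p.2 hy
        rw [← sub_zero (∑ k, partialD k (partialD k (entry Q p)) y), ← h0,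
          ← Finset.sum_sub_distrib, Finset.mul_sum]
        refine Finset.sum_congr rfl fun k _ => ?_
        rw [partialD_congr (fun z hz => hpd _ _ k (hq2.of_le (by norm_num))
          (hf2.of_le (by norm_num)) z hz) k hy]
        exact hpd _ _ k (contDiffOn_partialD isOpen_Omega hq2 k)
          (contDiffOn_partialD isOpen_Omega hf2 k) y hy
      rw [e]
      have h1 := h.abs_laplacian_le ha hb hc p hy
      have h2 : |σ * ∑ k, partialD k (partialD k (entry Q p)) y| ≤ gradfBound a b c / L := by
        rw [abs_mul, hσ, one_mul]; exact h1
      have h3 : gradfBound a b c / L ≤ (gradfBound a b c + 1) / L := by gcongr; linarith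
      linarith [(abs_le.1 h2).1]
    · intro y hy
      have h1 := hasDerivWithinAt_radial_entry hL h.anchoring_pos h.regular h.anchoring p hy
      have h2 := hasDerivWithinAt_radial_quadField (s * (ω / (3 + ω)))
        (s * (ω / (1 + ω)) * projEntry ez p.1 p.2) (s * projEntry ez p.1 p.2) p.1 p.2 hy
      refine ((h1.fun_sub h2).const_mul σ).congr_deriv ?_
      have h3 := Q0_robin_identity hω s (y p.1 * y p.2 - (1 : Mat3) p.1 p.2 / 3)
        (projEntry ez p.1 p.2) (entry Q p y)
      have h4 : Qsurf a b c y p.1 p.2 = s * (y p.1 * y p.2 - (1 : Mat3) p.1 p.2 / 3) := by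
        simp [Qsurf, outer, er, hy, div_eq_inv_mul, hs]
      have h5 : f y = s * projEntry ez p.1 p.2 + s * (ω / (3 + ω)) *
          (y p.1 * y p.2 - (1 : Mat3) p.1 p.2 / 3) - s * (ω / (1 + ω)) * projEntry ez p.1 p.2 := by
        simp [hf, quadField, hy]
      rw [h4, h5, h3]
      ring
    · intro y hy
      refine (le_abs_self _).trans ?_
      rw [abs_mul, hσ, one_mul]
      exact hout y hy
  have k1 := key 1 (by norm_num)
  have k2 := key (-1) (by norm_num)
  exact abs_le.2 ⟨by linarith, by linarith⟩

theorem tendsto_div_const_add_atTop {α : Type*} {l : Filter α} {u : α → ℝ} {κ : ℝ}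
    (hκ : 0 ≤ κ) (hu : Tendsto u l atTop) : Tendsto (fun k => u k / (κ + u k)) l (𝓝 1) := by
  have h1 : Tendsto (fun k => 1 - κ * (κ + u k)⁻¹) l (𝓝 (1 - κ * 0)) :=
    tendsto_const_nhds.sub ((tendsto_inv_atTop_zero.comp
      (tendsto_atTop_add_const_left _ κ hu)).const_mul κ)
  rw [mul_zero, sub_zero] at h1
  refine h1.congr' ?_
  filter_upwards [hu.eventually_gt_atTop 0] with k hk
  have : κ + u k ≠ 0 := by positivity
  field_simp
  ring

theorem tendsto_saturation {α : Type*} {l : Filter α} {u : α → ℝ} {κ : ℝ} {w : ℝ≥0∞}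
    (hκ : 0 < κ) (hu : ∀ k, 0 ≤ u k) (h : Tendsto (fun k => ENNReal.ofReal (u k)) l (𝓝 w)) :
    Tendsto (fun k => u k / (κ + u k)) l (𝓝 (if w = ⊤ then 1 else w.toReal / (κ + w.toReal))) := by
  split_ifs with hw
  · subst hw
    exact tendsto_div_const_add_atTop hκ.le (ENNReal.tendsto_ofReal_nhds_top.1 h)
  · have h1 : Tendsto u l (𝓝 w.toReal) := by
      refine ((ENNReal.tendsto_toReal hw).comp h).congr fun k => ?_
      simp [hu k]
    exact h1.div (tendsto_const_nhds.add h1) (by positivity)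

theorem tendsto_coef1 {α : Type*} {l : Filter α} {u : α → ℝ} {w : ℝ≥0∞} (hu : ∀ k, 0 ≤ u k)
    (h : Tendsto (fun k => ENNReal.ofReal (u k)) l (𝓝 w)) :
    Tendsto (fun k => coef1 (ENNReal.ofReal (u k))) l (𝓝 (coef1 w)) := by
  simp only [fun k => coef1_ofReal (hu k)]
  exact tendsto_saturation one_pos hu h

theorem tendsto_coef3 {α : Type*} {l : Filter α} {u : α → ℝ} {w : ℝ≥0∞} (hu : ∀ k, 0 ≤ u k)
    (h : Tendsto (fun k => ENNReal.ofReal (u k)) l (𝓝 w)) :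
    Tendsto (fun k => coef3 (ENNReal.ofReal (u k))) l (𝓝 (coef3 w)) := by
  simp only [fun k => coef3_ofReal (hu k)]
  exact tendsto_saturation three_pos hu h

/-- Uniform closeness, on balls, of solutions to the explicit configuration carrying the same
anchoring strength, in the limit of large elastic constant. -/
theorem exists_elastic_forall_abs_entry_sub_Q0_le {a b c : ℝ} (ha : 0 ≤ a) (hb : 0 < b)
    (hc : 0 < c) (ρ : ℝ) {ε : ℝ} (hε : 0 < ε) :
    ∃ Λ : ℝ, ∀ (L W : ℝ) (Q : E3 → Mat3), IsSolution a b c L W Q → Λ ≤ L →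
      ∀ x : E3, 1 ≤ ‖x‖ → ‖x‖ ≤ ρ → ∀ p,
        |entry Q p x - Q0 a b c (ENNReal.ofReal (W / L)) x p.1 p.2| ≤ ε := by
  obtain ⟨R₀, hR₀, hdev⟩ := exists_radius_abs_deviation_le ha hb hc (δ := ε / 4) (by positivity)
  have hG := gradfBound_nonneg ha hb hc
  set R := max R₀ (max ρ (16 * |sstar a b c| / ε)) with hR
  have hRR : R₀ ≤ R := le_max_left _ _
  have hRρ : ρ ≤ R := (le_max_left _ _).trans (le_max_right _ _)
  have hRs : 16 * |sstar a b c| / ε ≤ R := (le_max_right _ _).trans (le_max_right _ _)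
  have hR0 : 0 < R := by linarith
  refine ⟨max (R ^ 2) (2 * (gradfBound a b c + 1) * R ^ 2 / ε), fun L W Q h hL x hx1 hxρ p => ?_⟩
  have hL0 := h.elastic_pos
  have hL1 : R ^ 2 ≤ L := (le_max_left _ _).trans hL
  have hL2 : (gradfBound a b c + 1) / L * R ^ 2 ≤ ε / 2 := by
    have := (le_max_right _ _).trans hL
    rw [div_le_iff₀ hε] at this
    rw [div_mul_eq_mul_div, div_le_iff₀ hL0]
    linarith
  have h1 := h.abs_entry_sub_Q0_le ha hb hc (ε := ε / 2) (R := R) (by positivity)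
    (by linarith) p (fun y hy => ?_) hx1 (hxρ.trans hRρ)
  · linarith
  · have h2 := hdev R hRR L W Q h hL1 y hy p
    have h3 := abs_Q0_sub_Qinf_le a b c (div_pos h.anchoring_pos hL0) (x := y)
      (by rw [hy]; linarith) p.1 p.2
    have h4 : 4 * |sstar a b c| / ‖y‖ ≤ ε / 4 := by
      rw [div_le_iff₀ hε] at hRs
      rw [hy, div_le_iff₀ hR0]
      linarith
    have h5 := abs_sub_le (entry Q p y) (Qinf a b c p.1 p.2)
      (Q0 a b c (ENNReal.ofReal (W / L)) y p.1 p.2)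
    rw [abs_sub_comm (Qinf a b c p.1 p.2)] at h5
    rw [deviation] at h2
    linarith

theorem tendsto_uniform_Q0 {a b c : ℝ} {α : Type*} {l : Filter α} {u : α → ℝ} {w : ℝ≥0∞}
    (hu : ∀ k, 0 ≤ u k) (h : Tendsto (fun k => ENNReal.ofReal (u k)) l (𝓝 w)) {ε : ℝ}
    (hε : 0 < ε) : ∀ᶠ k in l, ∀ x : E3, 1 ≤ ‖x‖ → ∀ i j,
      |Q0 a b c (ENNReal.ofReal (u k)) x i j - Q0 a b c w x i j| < ε := by
  have h1 : Tendsto (fun k => 2 * |sstar a b c| *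
      (|coef3 (ENNReal.ofReal (u k)) - coef3 w| + |coef1 (ENNReal.ofReal (u k)) - coef1 w|)) l
      (𝓝 (2 * |sstar a b c| * (|coef3 w - coef3 w| + |coef1 w - coef1 w|))) :=
    ((((tendsto_coef3 hu h).sub_const _).abs).add
      (((tendsto_coef1 hu h).sub_const _).abs)).const_mul _
  simp only [sub_self, abs_zero, add_zero, mul_zero] at h1
  filter_upwards [h1.eventually_lt_const hε] with k hk x hx i j
  exact (abs_Q0_sub_le a b c _ _ hx i j).trans_lt hk

end

/-- small particle limit (Theorem 1.1, rescaled to `r₀ = 1`).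
If `(1/Lₖ, Wₖ/Lₖ) → (0, w)` with `w ∈ (0,∞]`, then finite-energy solutions `Qₖ` of the
Euler–Lagrange equations with weak anchoring converge locally uniformly on `Ω̄` to the
explicit quadrupolar configuration `Q₀ = Q_{0,w}`. -/
theorem small_particle_limit
    (a b c : ℝ) (ha : 0 ≤ a) (hb : 0 < b) (hc : 0 < c)
    (w : ℝ≥0∞) (hw : 0 < w)
    (L W : ℕ → ℝ) (hL : ∀ k, 0 < L k) (hW : ∀ k, 0 < W k)
    (Q : ℕ → E3 → Mat3)
    (hreg : ∀ k, RegC 2 (Q k))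
    (hmem : ∀ k, memH a b c (Q k))
    (hEL : ∀ k, isEL a b c (L k) (Q k))
    (hbc : ∀ k, weakAnchor a b c (L k) (W k) (Q k))
    (hfin : ∀ k, IntegrableOn
      (fun x => L k / 2 * gradSq (Q k) x + fpot a b c (Q k x)) Omega volume)
    (hL0 : Filter.Tendsto (fun k => 1 / L k) Filter.atTop (nhds (0 : ℝ)))
    (hWL : Filter.Tendsto (fun k => ENNReal.ofReal (W k / L k)) Filter.atTop (nhds w)) :
    ∀ i j, TendstoLocallyUniformlyOn (fun k x => Q k x i j)
      (fun x => Q0 a b c w x i j) Filter.atTop OmegaBar := by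
  intro i j
  have hsol : ∀ k, IsSolution a b c (L k) (W k) (Q k) := fun k =>
    ⟨hL k, hW k, hreg k, hmem k, hEL k, hbc k, hfin k⟩
  have hLtop : Tendsto L atTop atTop := by
    have h1 : Tendsto (fun k => (L k)⁻¹) atTop (nhdsWithin 0 (Ioi 0)) :=
      tendsto_nhdsWithin_iff.2 ⟨by simpa only [one_div] using hL0,
        Eventually.of_forall fun k => inv_pos.2 (hL k)⟩
    exact h1.inv_tendsto_nhdsGT_zero.congr fun k => inv_inv (L k)
  rw [Metric.tendstoLocallyUniformlyOn_iff]
  intro ε hε x hx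
  obtain ⟨Λ, hΛ⟩ := exists_elastic_forall_abs_entry_sub_Q0_le ha hb hc (‖x‖ + 1)
    (ε := ε / 2) (by positivity)
  refine ⟨OmegaBar ∩ ball x 1, inter_mem_nhdsWithin _ (ball_mem_nhds x one_pos), ?_⟩
  filter_upwards [hLtop.eventually_ge_atTop Λ,
    tendsto_uniform_Q0 (a := a) (b := b) (c := c) (fun k => (div_pos (hW k) (hL k)).le) hWL
      (ε := ε / 2) (by positivity)] with k hk hQ y hy
  have hyx : ‖y‖ ≤ ‖x‖ + 1 := by
    have h1 : ‖y - x‖ < 1 := by simpa [dist_eq_norm] using hy.2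
    linarith [norm_le_norm_add_norm_sub' y x, norm_sub_rev y x]
  have h2 := hΛ (L k) (W k) (Q k) (hsol k) hk y hy.1 hyx (i, j)
  have h3 := hQ y hy.1 i j
  rw [dist_comm, Real.dist_eq]
  exact (abs_sub_le (Q k y i j) (Q0 a b c (ENNReal.ofReal (W k / L k)) y i j) _).trans_lt
    (by simp only [entry] at h2; linarith)
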